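/- arXiv:2101.07008 — 3 statements merged into one kernel-verified Lean document; each statement's English description precedes it below -/
import Mathlib

section
/- Let Ω ⊆ ℝⁿ be open, W ∈ C¹(Ω) positive, A(x) a smooth symmetric positive definite matrix field, and suppose v ∈ C²(Ω) is positive and satisfies div(W(x) A(x)∇v) + H(x) v = 0 on Ω for some H ∈ L¹_loc(Ω). Then for every u ∈ C¹_c(Ω) (real-valued), ∫_Ω W(x) ⟨A(x)∇u, ∇u⟩ dx ≥ ∫_Ω H(x) u² dx. -/
open Matrix MeasureTheory

/-- The gradient of `f` at `x` as a vector of partial derivatives. -/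
noncomputable def egrad {n : ℕ} (f : EuclideanSpace ℝ (Fin n) → ℝ)
    (x : EuclideanSpace ℝ (Fin n)) : Fin n → ℝ :=
  fun i => fderiv ℝ f x (EuclideanSpace.single i 1)

/-- A function continuous on an open set and vanishing off a compact subset of it is integrable. -/
theorem ContinuousOn.integrable_of_eq_zero_of_notMem_isCompact {E : Type*}
    [NormedAddCommGroup E] [MeasurableSpace E] [BorelSpace E]
    {μ : Measure E} [IsFiniteMeasureOnCompacts μ] {Ω K : Set E} {F : E → ℝ} (hΩ : IsOpen Ω)
    (hF : ContinuousOn F Ω) (hK : IsCompact K) (hKΩ : K ⊆ Ω) (h0 : ∀ x, x ∉ K → F x = 0) :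
    Integrable F μ := by
  have hsupp : tsupport F ⊆ K :=
    closure_minimal (fun x hx => by_contra fun h => hx (h0 x h)) hK.isClosed
  exact (continuous_of_tsupport fun x hx =>
    hF.continuousAt (hΩ.mem_nhds (hKΩ (hsupp hx)))).integrable_of_hasCompactSupport
      (HasCompactSupport.intro hK h0)

/-- The pointwise Picone inequality for a positive semidefinite matrix. -/
theorem Matrix.PosSemidef.picone {ι : Type*} [Fintype ι] {S : Matrix ι ι ℝ} (hS : S.PosSemidef)
    (p q : ι → ℝ) (t : ℝ) :
    (2 * t) * (p ⬝ᵥ S *ᵥ q) - t ^ 2 * (q ⬝ᵥ S *ᵥ q) ≤ S *ᵥ p ⬝ᵥ p := by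
  have h := hS.dotProduct_mulVec_nonneg (p - t • q)
  have hsymm : q ⬝ᵥ S *ᵥ p = p ⬝ᵥ S *ᵥ q := by
    have hT : Sᵀ = S := by simpa using hS.isHermitian.eq
    rw [dotProduct_mulVec, ← mulVec_transpose, hT, dotProduct_comm]
  simp only [star_trivial, mulVec_sub, mulVec_smul, dotProduct_sub, sub_dotProduct,
    dotProduct_smul, smul_dotProduct, smul_eq_mul, hsymm] at h
  rw [dotProduct_comm (S *ᵥ p) p]
  linarith

theorem egrad_eq_zero_of_notMem_tsupport {n : ℕ} {f : EuclideanSpace ℝ (Fin n) → ℝ}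
    {x : EuclideanSpace ℝ (Fin n)} (hx : x ∉ tsupport f) : egrad f x = 0 := by
  ext i
  simp [egrad, fderiv_of_notMem_tsupport ℝ hx]

theorem ContDiffOn.egrad_apply {n : ℕ} {f : EuclideanSpace ℝ (Fin n) → ℝ}
    {Ω : Set (EuclideanSpace ℝ (Fin n))} {m k : WithTop ℕ∞} (hf : ContDiffOn ℝ k f Ω)
    (hΩ : IsOpen Ω) (hmk : m + 1 ≤ k) (i : Fin n) : ContDiffOn ℝ m (fun x => egrad f x i) Ω :=
  (hf.fderiv_of_isOpen hΩ hmk).clm_apply contDiffOn_const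

/-- The gradient of `u ^ 2 / v`. -/
theorem egrad_sq_div {n : ℕ} {u v : EuclideanSpace ℝ (Fin n) → ℝ} {x : EuclideanSpace ℝ (Fin n)}
    (hu : DifferentiableAt ℝ u x) (hv : DifferentiableAt ℝ v x) (hx : v x ≠ 0) :
    egrad (fun y => u y ^ 2 / v y) x =
      (2 * (u x / v x)) • egrad u x - (u x / v x) ^ 2 • egrad v x := by
  have h := (hu.hasFDerivAt.pow 2).mul ((hasDerivAt_inv hx).comp_hasFDerivAt x hv.hasFDerivAt)
  ext i
  change fderiv ℝ (fun y => u y ^ 2 * (v y)⁻¹) x _ = _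
  erw [h.fderiv]
  simp [egrad]
  field_simp
  ring

/-- Integration by parts against a compactly supported function: only the behaviour of the
vector field near the support matters. -/
theorem integral_mul_fderiv_eq_neg_of_contDiffOn {E : Type*} [NormedAddCommGroup E]
    [NormedSpace ℝ E] [FiniteDimensional ℝ E] [MeasurableSpace E] [BorelSpace E]
    {μ : Measure E} [μ.IsAddHaarMeasure] {Ω K : Set E} {f g : E → ℝ} (hΩ : IsOpen Ω)
    (hf : ContDiffOn ℝ 1 f Ω) (hg : ContDiffOn ℝ 1 g Ω) (hK : IsCompact K) (hKΩ : K ⊆ Ω)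
    (h0 : ∀ x, x ∉ K → f x = 0) (e : E) :
    Integrable (fun x => f x * fderiv ℝ g x e) μ ∧ Integrable (fun x => fderiv ℝ f x e * g x) μ ∧
      ∫ x, f x * fderiv ℝ g x e ∂μ = -∫ x, fderiv ℝ f x e * g x ∂μ := by
  have hsupp : tsupport f ⊆ K :=
    closure_minimal (fun x hx => by_contra fun h => hx (h0 x h)) hK.isClosed
  have hf0 : ∀ x, x ∉ K → fderiv ℝ f x = 0 := fun x hx =>
    fderiv_of_notMem_tsupport ℝ fun h => hx (hsupp h)
  have hf' := (hf.continuousOn_fderiv_of_isOpen hΩ le_rfl).clm_apply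
    (continuousOn_const (c := e))
  have hg' := (hg.continuousOn_fderiv_of_isOpen hΩ le_rfl).clm_apply
    (continuousOn_const (c := e))
  have hfg' : Integrable (fun x => f x * fderiv ℝ g x e) μ :=
    (hf.continuousOn.mul hg').integrable_of_eq_zero_of_notMem_isCompact hΩ hK hKΩ
      fun x hx => by simp [h0 x hx]
  have hf'g : Integrable (fun x => fderiv ℝ f x e * g x) μ :=
    (hf'.mul hg.continuousOn).integrable_of_eq_zero_of_notMem_isCompact hΩ hK hKΩ
      fun x hx => by simp [hf0 x hx]
  have hfg : Integrable (fun x => f x * g x) μ :=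
    (hf.continuousOn.mul hg.continuousOn).integrable_of_eq_zero_of_notMem_isCompact hΩ hK hKΩ
      fun x hx => by simp [h0 x hx]
  refine ⟨hfg', hf'g,
    integral_mul_fderiv_eq_neg_fderiv_mul_of_integrable hf'g hfg' hfg (fun x _ => ?_) fun x hx =>
      (hg.differentiableOn one_ne_zero).differentiableAt (hΩ.mem_nhds (hKΩ (hsupp hx)))⟩
  by_cases hx : x ∈ tsupport f
  · exact (hf.differentiableOn one_ne_zero).differentiableAt (hΩ.mem_nhds (hKΩ (hsupp hx)))
  · exact (differentiableAt_const (0 : ℝ)).congr_of_eventuallyEq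
      (notMem_tsupport_iff_eventuallyEq.mp hx)

/-- Hardy inequality with a Bessel pair via a positive supersolution, case `p = 2`:
if `v > 0` solves `div(W A ∇v) + H v = 0` on a bounded domain `Ω`, then
`∫_Ω W ⟨A∇u,∇u⟩ ≥ ∫_Ω H u²` for all `u ∈ C¹_c(Ω)`. -/
theorem hardy_bessel_pair {n : ℕ} (Ω : Set (EuclideanSpace ℝ (Fin n)))
    (hΩo : IsOpen Ω) (hΩc : IsConnected Ω) (hΩb : Bornology.IsBounded Ω)
    (W H v : EuclideanSpace ℝ (Fin n) → ℝ)
    (A : EuclideanSpace ℝ (Fin n) → Matrix (Fin n) (Fin n) ℝ)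
    (hW : ContDiffOn ℝ 1 W Ω) (hWpos : ∀ x ∈ Ω, 0 < W x)
    (hAsmooth : ∀ i j, ContDiffOn ℝ (⊤ : ℕ∞) (fun x => A x i j) Ω)
    (hApd : ∀ x ∈ Ω, (A x).PosDef)
    (hH : LocallyIntegrableOn H Ω)
    (hv : ContDiffOn ℝ 2 v Ω) (hvpos : ∀ x ∈ Ω, 0 < v x)
    (hveq : ∀ x ∈ Ω,
      (∑ i, fderiv ℝ (fun y => W y * (A y).mulVec (egrad v y) i) x
          (EuclideanSpace.single i 1)) + H x * v x = 0)
    (u : EuclideanSpace ℝ (Fin n) → ℝ)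
    (hu : ContDiff ℝ 1 u) (hucs : HasCompactSupport u) (husupp : tsupport u ⊆ Ω) :
    ∫ x in Ω, H x * u x ^ 2 ≤ ∫ x in Ω, W x * ((A x).mulVec (egrad u x) ⬝ᵥ egrad u x) := by
  have hu0 : ∀ x, x ∉ tsupport u → u x = 0 := fun x => image_eq_zero_of_notMem_tsupport
  set f : EuclideanSpace ℝ (Fin n) → ℝ := fun x => u x ^ 2 / v x with hfdef
  set g : Fin n → EuclideanSpace ℝ (Fin n) → ℝ :=
    fun i y => W y * (A y).mulVec (egrad v y) i with hgdef
  have hf : ContDiffOn ℝ 1 f Ω :=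
    (hu.contDiffOn.pow 2).div (hv.of_le one_le_two) fun x hx => (hvpos x hx).ne'
  have hA : ∀ i j, ContDiffOn ℝ 1 (fun x => A x i j) Ω := fun i j =>
    (hAsmooth i j).of_le (by exact_mod_cast le_top)
  have hg : ∀ i, ContDiffOn ℝ 1 (g i) Ω := fun i =>
    hW.mul <| by
      simp only [mulVec, dotProduct]
      exact ContDiffOn.sum fun j _ =>
        (hA i j).mul (hv.egrad_apply hΩo one_add_one_eq_two.le j)
  have hparts := fun i => integral_mul_fderiv_eq_neg_of_contDiffOn (μ := volume) hΩo hf (hg i)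
    hucs husupp (fun x hx => by simp [hfdef, hu0 x hx]) (EuclideanSpace.single i 1)
  have hRcont : ContinuousOn (fun x => W x * ((A x).mulVec (egrad u x) ⬝ᵥ egrad u x)) Ω := by
    have hgu : ∀ i, ContinuousOn (fun x => egrad u x i) Ω := fun i =>
      (hu.contDiffOn.egrad_apply (m := 0) hΩo (by norm_num) i).continuousOn
    simp only [mulVec, dotProduct]
    exact hW.continuousOn.mul (continuousOn_finsetSum _ fun i _ =>
      (continuousOn_finsetSum _ fun j _ => (hA i j).continuousOn.mul (hgu j)).mul (hgu i))
  have hR0 : ∀ x, x ∉ tsupport u →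
      W x * ((A x).mulVec (egrad u x) ⬝ᵥ egrad u x) = 0 := fun x hx => by
    simp [egrad_eq_zero_of_notMem_tsupport hx]
  rw [setIntegral_eq_integral_of_forall_compl_eq_zero fun x hx => by
      simp [hu0 x fun h => hx (husupp h)],
    setIntegral_eq_integral_of_forall_compl_eq_zero fun x hx => hR0 x fun h => hx (husupp h)]
  calc ∫ x, H x * u x ^ 2
      = ∫ x, -∑ i, f x * fderiv ℝ (g i) x (EuclideanSpace.single i 1) := by
        congr 1
        ext x
        by_cases hx : x ∈ Ω
        · have hvx := (hvpos x hx).ne'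
          rw [← Finset.mul_sum, eq_neg_of_add_eq_zero_left (hveq x hx)]
          simp only [hfdef]
          field_simp
        · simp [hfdef, hu0 x fun h => hx (husupp h)]
    _ = ∫ x, ∑ i, fderiv ℝ f x (EuclideanSpace.single i 1) * g i x := by
        rw [integral_neg, integral_finsetSum _ fun i _ => (hparts i).1,
          integral_finsetSum _ fun i _ => (hparts i).2.1, ← Finset.sum_neg_distrib]
        exact Finset.sum_congr rfl fun i _ => by rw [(hparts i).2.2, neg_neg]
    _ ≤ ∫ x, W x * ((A x).mulVec (egrad u x) ⬝ᵥ egrad u x) := by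
        refine integral_mono (integrable_finsetSum _ fun i _ => (hparts i).2.1)
          (hRcont.integrable_of_eq_zero_of_notMem_isCompact hΩo hucs husupp hR0) fun x => ?_
        have hsum : ∑ i, fderiv ℝ f x (EuclideanSpace.single i 1) * g i x =
            W x * (egrad f x ⬝ᵥ (A x).mulVec (egrad v x)) := by
          simp only [hgdef, dotProduct, Finset.mul_sum, egrad]
          exact Finset.sum_congr rfl fun i _ => mul_left_comm _ _ _
        simp only [hsum]
        by_cases hx : x ∈ tsupport u
        · have hxΩ := husupp hx
          refine mul_le_mul_of_nonneg_left ?_ (hWpos x hxΩ).le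
          rw [egrad_sq_div (hu.differentiable one_ne_zero x)
            ((hv.differentiableOn two_ne_zero).differentiableAt (hΩo.mem_nhds hxΩ))
            (hvpos x hxΩ).ne', sub_dotProduct, smul_dotProduct, smul_dotProduct]
          exact (hApd x hxΩ).posSemidef.picone _ _ _
        · have hfx : x ∉ tsupport f := fun h => hx <| closure_mono
            (Function.support_subset_iff'.mpr fun y hy => by
              simp [hfdef, Function.notMem_support.mp hy]) h
          rw [egrad_eq_zero_of_notMem_tsupport hfx, hR0 x hx]
          simp
end

section
/- Let Ω ⊆ ℝⁿ be a bounded domain, 1 < p < n, W ∈ C²(Ω) and H ∈ L¹_loc(Ω) positive, and suppose there exists v ∈ C⁴(Ω) with v > 0, −Δv > 0 a.e., and Δ(W(x)|Δv|^{p−2}Δv) ≥ H(x) v^{p−1}. Then for all nonnegative u ∈ C²_c(Ω), ∫_Ω W(x)|Δu|^p dx ≥ ∫_Ω H(x) u^p dx. -/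
open MeasureTheory

/-- The Laplacian of `f` at `x` as the sum of second partial derivatives. -/
noncomputable def elap {n : ℕ} (f : EuclideanSpace ℝ (Fin n) → ℝ)
    (x : EuclideanSpace ℝ (Fin n)) : ℝ :=
  ∑ i, fderiv ℝ (fun y => fderiv ℝ f y (EuclideanSpace.single i 1)) x
    (EuclideanSpace.single i 1)

open Set Filter Topology

theorem ContDiffAt.eventually_differentiableAt_of_two {E : Type*} [NormedAddCommGroup E]
    [NormedSpace ℝ E] {f : E → ℝ} {x : E} (hf : ContDiffAt ℝ 2 f x) :
    ∀ᶠ y in 𝓝 x, DifferentiableAt ℝ f y :=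
  (hf.eventually (by simp)).mono fun _ hy => hy.differentiableAt (by simp)

theorem ContDiffAt.differentiableAt_fderiv_apply {E : Type*} [NormedAddCommGroup E]
    [NormedSpace ℝ E] {f : E → ℝ} {x : E} (hf : ContDiffAt ℝ 2 f x) (e : E) :
    DifferentiableAt ℝ (fun y => fderiv ℝ f y e) x :=
  ((hf.fderiv_right (m := 1) (by norm_num)).differentiableAt (by simp)).clm_apply
    (differentiableAt_const e)

theorem ContDiffOn.fderiv_apply_of_isOpen {E : Type*} [NormedAddCommGroup E]
    [NormedSpace ℝ E] {f : E → ℝ} {s : Set E} {m n : WithTop ℕ∞} (hf : ContDiffOn ℝ n f s)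
    (hs : IsOpen s) (hmn : m + 1 ≤ n) (e : E) :
    ContDiffOn ℝ m (fun y => fderiv ℝ f y e) s :=
  (hf.fderiv_of_isOpen hs hmn).clm_apply contDiffOn_const

theorem contDiffOn_elap {n : ℕ} {f : EuclideanSpace ℝ (Fin n) → ℝ}
    {s : Set (EuclideanSpace ℝ (Fin n))} {m k l : WithTop ℕ∞} (hf : ContDiffOn ℝ k f s)
    (hs : IsOpen s) (hm : m + 1 ≤ l) (hl : l + 1 ≤ k) : ContDiffOn ℝ m (elap f) s :=
  ContDiffOn.sum fun _ _ => (hf.fderiv_apply_of_isOpen hs hl _).fderiv_apply_of_isOpen hs hm _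

theorem elap_congr {n : ℕ} {f g : EuclideanSpace ℝ (Fin n) → ℝ} {x : EuclideanSpace ℝ (Fin n)}
    (h : f =ᶠ[𝓝 x] g) : elap f x = elap g x := by
  refine Finset.sum_congr rfl fun i _ => ?_
  have : (fun y => fderiv ℝ f y (EuclideanSpace.single i 1)) =ᶠ[𝓝 x]
      fun y => fderiv ℝ g y (EuclideanSpace.single i 1) :=
    (h.fderiv (𝕜 := ℝ)).mono fun y hy => by simp only [hy]
  rw [this.fderiv_eq]

theorem elap_zero {n : ℕ} (x : EuclideanSpace ℝ (Fin n)) : elap (fun _ => 0) x = 0 := by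
  simp [elap]

theorem elap_add_const_mul {n : ℕ} {f g : EuclideanSpace ℝ (Fin n) → ℝ}
    {x : EuclideanSpace ℝ (Fin n)} (hf : ContDiffAt ℝ 2 f x) (hg : ContDiffAt ℝ 2 g x) (c : ℝ) :
    elap (fun y => f y + c * g y) x = elap f x + c * elap g x := by
  unfold elap
  rw [Finset.mul_sum, ← Finset.sum_add_distrib]
  refine Finset.sum_congr rfl fun i _ => ?_
  set e : EuclideanSpace ℝ (Fin n) := EuclideanSpace.single i 1
  have h1 : (fun y => fderiv ℝ (fun y => f y + c * g y) y e) =ᶠ[𝓝 x]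
      fun y => fderiv ℝ f y e + c * fderiv ℝ g y e := by
    filter_upwards [hf.eventually_differentiableAt_of_two,
      hg.eventually_differentiableAt_of_two] with y hfy hgy
    rw [(hfy.hasFDerivAt.fun_add (hgy.hasFDerivAt.const_mul c)).fderiv]
    simp
  rw [h1.fderiv_eq, ((hf.differentiableAt_fderiv_apply e).hasFDerivAt.fun_add
    ((hg.differentiableAt_fderiv_apply e).hasFDerivAt.const_mul c)).fderiv]
  simp

/-- The second order condition at a local maximum, for the possibly degenerate second
derivatives of a function that is merely continuous. -/
theorem elap_nonpos_of_isLocalMax {n : ℕ} {g : EuclideanSpace ℝ (Fin n) → ℝ}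
    {x : EuclideanSpace ℝ (Fin n)} (hmax : IsLocalMax g x)
    (hcont : ∀ᶠ y in 𝓝 x, ContinuousAt g y) : elap g x ≤ 0 := by
  refine Finset.sum_nonpos fun i _ => ?_
  set e : EuclideanSpace ℝ (Fin n) := EuclideanSpace.single i 1
  by_contra! hpos
  set h : EuclideanSpace ℝ (Fin n) → ℝ := fun y => fderiv ℝ g y e
  have hd : DifferentiableAt ℝ h x := by
    by_contra hnd
    simp [fderiv_zero_of_not_differentiableAt hnd] at hpos
  have hline (t : ℝ) : HasDerivAt (fun t : ℝ => x + t • e) e t := by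
    simpa using ((hasDerivAt_id t).smul_const e).const_add x
  have hlt : Tendsto (fun t : ℝ => x + t • e) (𝓝 0) (𝓝 x) := by
    simpa using (hline 0).continuousAt.tendsto
  have hh0 : h x = 0 := by simp [h, hmax.fderiv_eq_zero]
  have hk : HasDerivAt (fun t : ℝ => h (x + t • e)) (fderiv ℝ h x e) 0 := by
    have : HasFDerivAt h (fderiv ℝ h x) (x + (0 : ℝ) • e) := by simpa using hd.hasFDerivAt
    exact this.comp_hasDerivAt 0 (hline 0)
  have hkpos : ∀ᶠ t in 𝓝[>] (0 : ℝ), 0 < h (x + t • e) := by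
    have := (hasDerivAt_iff_tendsto_slope.1 hk).eventually_const_lt hpos
    filter_upwards [this.filter_mono (nhdsWithin_mono 0 fun t (ht : 0 < t) => ht.ne'),
      self_mem_nhdsWithin] with t ht ht0
    have ht0 : 0 < t := ht0
    rw [slope_def_field] at ht
    simp only [zero_smul, add_zero, hh0, sub_zero] at ht
    exact (div_pos_iff_of_pos_right ht0).1 ht
  have hev := hkpos.and ((hlt.eventually (hmax.and hcont)).filter_mono nhdsWithin_le_nhds)
  obtain ⟨δ, hδ, hsub⟩ := mem_nhdsGT_iff_exists_Ioo_subset.1 hev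
  have hδ : 0 < δ := hδ
  have hmono : StrictMonoOn (fun t : ℝ => g (x + t • e)) (Icc 0 (δ / 2)) := by
    refine strictMonoOn_of_deriv_pos (convex_Icc _ _) ?_ ?_
    · intro t ht
      have hc : ContinuousAt g (x + t • e) := by
        rcases ht.1.eq_or_lt with rfl | h0
        · simpa using hcont.self_of_nhds
        · exact (hsub ⟨h0, by linarith [ht.2]⟩).2.2
      exact (ContinuousAt.comp (f := fun t : ℝ => x + t • e) hc
        (hline t).continuousAt).continuousWithinAt
    · intro t ht
      rw [interior_Icc] at ht
      have hp : 0 < h (x + t • e) := (hsub ⟨ht.1, by linarith [ht.2]⟩).1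
      have hdg : DifferentiableAt ℝ g (x + t • e) := by
        by_contra hnd
        simp [h, fderiv_zero_of_not_differentiableAt hnd] at hp
      have := hdg.hasFDerivAt.comp_hasDerivAt t (hline t)
      exact this.deriv ▸ hp
  have h1 := hmono (left_mem_Icc.2 (by positivity)) (right_mem_Icc.2 (by positivity))
    (by positivity : (0 : ℝ) < δ / 2)
  have h2 := (hsub ⟨by positivity, by linarith⟩ : δ / 2 ∈ _).2.1
  simp only [zero_smul, add_zero] at h1
  linarith

theorem integrableOn_of_continuousOn_of_eq_zero {E : Type*} [TopologicalSpace E] [T2Space E]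
    [MeasurableSpace E] [OpensMeasurableSpace E] {μ : Measure E} [IsFiniteMeasureOnCompacts μ]
    {Ω K : Set E} {f : E → ℝ} (hΩ : MeasurableSet Ω)
    (hK : IsCompact K) (hKΩ : K ⊆ Ω) (hf : ContinuousOn f Ω) (h0 : ∀ x ∈ Ω \ K, f x = 0) :
    IntegrableOn f Ω μ := by
  have h1 : IntegrableOn f K μ := (hf.mono hKΩ).integrableOn_compact' hK hK.measurableSet
  exact h1.of_forall_sdiff_eq_zero hΩ h0

theorem integral_fderiv_apply_eq_zero {E : Type*} [NormedAddCommGroup E] [NormedSpace ℝ E]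
    [FiniteDimensional ℝ E] [MeasurableSpace E] [BorelSpace E] {μ : Measure E}
    [μ.IsAddHaarMeasure] {F : E → ℝ} (hF : ContDiff ℝ 1 F) (hc : HasCompactSupport F) (e : E) :
    ∫ x, fderiv ℝ F x e ∂μ = 0 := by
  have hF' : Integrable (fun x => fderiv ℝ F x e) μ :=
    ((hF.continuous_fderiv (by simp)).clm_apply continuous_const).integrable_of_hasCompactSupport
      (hc.fderiv_apply (𝕜 := ℝ) e)
  have hi := hF.continuous.integrable_of_hasCompactSupport (μ := μ) hc
  have := integral_mul_fderiv_eq_neg_fderiv_mul_of_integrable (μ := μ) (f := F)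
    (g := fun _ => (1 : ℝ)) (v := e) (by simpa using hF') (by simp) (by simpa using hi)
    (fun x _ => hF.differentiable (by simp) x) (fun x _ => by fun_prop)
  simpa using this

/-- Green's second identity for a `C²` function and a compactly supported one. -/
theorem setIntegral_mul_elap_comm {n : ℕ} {Ω K : Set (EuclideanSpace ℝ (Fin n))}
    {f g : EuclideanSpace ℝ (Fin n) → ℝ} (hΩ : IsOpen Ω) (hK : IsCompact K) (hKΩ : K ⊆ Ω)
    (hf : ContDiffOn ℝ 2 f Ω) (hg : ContDiffOn ℝ 2 g Ω) (h0 : ∀ x ∈ Ω \ K, f x = 0) :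
    ∫ x in Ω, f x * elap g x = ∫ x in Ω, g x * elap f x := by
  have hUo : IsOpen (Ω \ K) := hΩ.sdiff hK.isClosed
  have hf0 : ∀ x ∈ Ω \ K, f =ᶠ[𝓝 x] fun _ => 0 := fun x hx =>
    eventually_of_mem (hUo.mem_nhds hx) h0
  have hi1 : IntegrableOn (fun x => f x * elap g x) Ω :=
    integrableOn_of_continuousOn_of_eq_zero hΩ.measurableSet hK hKΩ
      (hf.continuousOn.mul (contDiffOn_elap (m := 0) (l := 1) hg hΩ (by norm_num)
        (by norm_num)).continuousOn) fun x hx => by simp [h0 x hx]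
  have hi2 : IntegrableOn (fun x => g x * elap f x) Ω :=
    integrableOn_of_continuousOn_of_eq_zero hΩ.measurableSet hK hKΩ
      (hg.continuousOn.mul (contDiffOn_elap (m := 0) (l := 1) hf hΩ (by norm_num)
        (by norm_num)).continuousOn) fun x hx => by
          simp [elap_congr (hf0 x hx), elap_zero]
  rw [← sub_eq_zero, ← integral_sub hi1 hi2]
  let e : Fin n → EuclideanSpace ℝ (Fin n) := fun i => EuclideanSpace.single i 1
  let F : Fin n → EuclideanSpace ℝ (Fin n) → ℝ := fun i =>
    Ω.indicator fun x => f x * fderiv ℝ g x (e i) - g x * fderiv ℝ f x (e i)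
  have hF0 : ∀ i, ∀ x ∉ K, F i x = 0 := by
    intro i x hx
    by_cases hxΩ : x ∈ Ω
    · simp [F, hxΩ, h0 x ⟨hxΩ, hx⟩, (hf0 x ⟨hxΩ, hx⟩).fderiv_eq]
    · simp [F, hxΩ]
  have hFΩ : ∀ i, ∀ x ∈ Ω, F i =ᶠ[𝓝 x] fun x => f x * fderiv ℝ g x (e i) -
      g x * fderiv ℝ f x (e i) := fun i x hx =>
    eventually_of_mem (hΩ.mem_nhds hx) fun y hy => by simp [F, hy]
  have hFK : ∀ i, ∀ x ∉ K, F i =ᶠ[𝓝 x] fun _ => 0 := fun i x hx =>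
    eventually_of_mem (hK.isClosed.isOpen_compl.mem_nhds hx) fun y hy => hF0 i y hy
  have hFC : ∀ i, ContDiff ℝ 1 (F i) := by
    intro i
    rw [contDiff_iff_contDiffAt]
    intro x
    by_cases hx : x ∈ K
    · refine ContDiffAt.congr_of_eventuallyEq ?_ (hFΩ i x (hKΩ hx))
      have hn := hΩ.mem_nhds (hKΩ hx)
      exact (((hf.of_le (by norm_num)).mul
        (hg.fderiv_apply_of_isOpen hΩ (by norm_num) _)).sub ((hg.of_le (by norm_num)).mul
        (hf.fderiv_apply_of_isOpen hΩ (by norm_num) _))).contDiffAt hn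
    · exact contDiffAt_const.congr_of_eventuallyEq (hFK i x hx)
  have hFc : ∀ i, HasCompactSupport (F i) := fun i => HasCompactSupport.intro hK (hF0 i)
  have hsum : ∀ x, Ω.indicator (fun x => f x * elap g x - g x * elap f x) x =
      ∑ i, fderiv ℝ (F i) x (e i) := by
    intro x
    by_cases hx : x ∈ Ω
    · have hfx := hf.contDiffAt (hΩ.mem_nhds hx)
      have hgx := hg.contDiffAt (hΩ.mem_nhds hx)
      rw [indicator_of_mem hx, elap, elap, Finset.mul_sum, Finset.mul_sum,
        ← Finset.sum_sub_distrib]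
      refine Finset.sum_congr rfl fun i _ => ?_
      rw [(hFΩ i x hx).fderiv_eq, ((((hfx.differentiableAt (by simp)).hasFDerivAt).fun_mul
        (hgx.differentiableAt_fderiv_apply (e i)).hasFDerivAt).fun_sub
        (((hgx.differentiableAt (by simp)).hasFDerivAt).fun_mul
        (hfx.differentiableAt_fderiv_apply (e i)).hasFDerivAt)).fderiv]
      simp [e]
      ring
    · rw [indicator_of_notMem hx]
      refine (Finset.sum_eq_zero fun i _ => ?_).symm
      rw [(hFK i x fun h => hx (hKΩ h)).fderiv_eq]
      simp
  rw [← integral_indicator hΩ.measurableSet]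
  simp_rw [hsum]
  rw [integral_finsetSum _ fun i _ => ((hFC i).continuous_fderiv (by simp)).clm_apply
    continuous_const |>.integrable_of_hasCompactSupport ((hFc i).fderiv_apply (𝕜 := ℝ) (e i))]
  exact Finset.sum_eq_zero fun i _ => integral_fderiv_apply_eq_zero (hFC i) (hFc i) (e i)

/-- The Laplacian of `a ^ p * b ^ (1 - p)` dominates its first order expansion, by convexity
of `(s, t) ↦ s ^ p * t ^ (1 - p)`. -/
theorem le_elap_rpow_mul_rpow {n : ℕ} {a b : EuclideanSpace ℝ (Fin n) → ℝ}
    {x : EuclideanSpace ℝ (Fin n)} {p : ℝ} (hp : 1 < p) (ha : ContDiffAt ℝ 2 a x)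
    (hb : ContDiffAt ℝ 2 b x) (ha0 : 0 < a x) (hb0 : 0 < b x) :
    p * (a x ^ (p - 1) * b x ^ (1 - p)) * elap a x + (1 - p) * (a x ^ p * b x ^ (-p)) * elap b x
      ≤ elap (fun y => a y ^ p * b y ^ (1 - p)) x := by
  unfold elap
  rw [Finset.mul_sum, Finset.mul_sum, ← Finset.sum_add_distrib]
  refine Finset.sum_le_sum fun i _ => ?_
  set e : EuclideanSpace ℝ (Fin n) := EuclideanSpace.single i 1
  have h1 : (fun y => fderiv ℝ (fun y => a y ^ p * b y ^ (1 - p)) y e) =ᶠ[𝓝 x]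
      fun y => p * (a y ^ (p - 1) * b y ^ (1 - p)) * fderiv ℝ a y e +
        (1 - p) * (a y ^ p * b y ^ (-p)) * fderiv ℝ b y e := by
    filter_upwards [ha.eventually_differentiableAt_of_two,
      hb.eventually_differentiableAt_of_two, ha.continuousAt.eventually_const_lt ha0,
      hb.continuousAt.eventually_const_lt hb0] with y hay hby ha0 hb0
    rw [((hay.hasFDerivAt.rpow_const (Or.inl ha0.ne')).fun_mul
      (hby.hasFDerivAt.rpow_const (p := 1 - p) (Or.inl hb0.ne'))).fderiv]
    simp [show 1 - p - 1 = -p by ring]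
    ring
  have hA := (ha.differentiableAt (by simp)).hasFDerivAt
  have hB := (hb.differentiableAt (by simp)).hasFDerivAt
  have hA' := (ha.differentiableAt_fderiv_apply e).hasFDerivAt
  have hB' := (hb.differentiableAt_fderiv_apply e).hasFDerivAt
  have hr (q : ℝ) := hA.rpow_const (p := q) (Or.inl ha0.ne')
  have hs (q : ℝ) := hB.rpow_const (p := q) (Or.inl hb0.ne')
  rw [h1.fderiv_eq, (((((hr (p - 1)).fun_mul (hs (1 - p))).const_mul p).fun_mul hA').fun_add
    ((((hr p).fun_mul (hs (-p))).const_mul (1 - p)).fun_mul hB')).fderiv]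
  simp only [add_apply, smul_apply, smul_eq_mul]
  have hsq : 0 ≤ p * (p - 1) * (a x ^ (p - 1 - 1) * b x ^ (-p - 1)) *
      (b x * fderiv ℝ a x e - a x * fderiv ℝ b x e) ^ 2 := by
    have : 0 < p - 1 := by linarith
    positivity
  have ea1 : a x ^ (p - 1) = a x ^ (p - 1 - 1) * a x := by
    rw [← Real.rpow_add_one ha0.ne']; ring_nf
  have ea : a x ^ p = a x ^ (p - 1 - 1) * a x * a x := by
    rw [← ea1, ← Real.rpow_add_one ha0.ne']; ring_nf
  have eb1 : b x ^ (-p) = b x ^ (-p - 1) * b x := by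
    rw [← Real.rpow_add_one hb0.ne']; ring_nf
  have eb : b x ^ (1 - p) = b x ^ (-p - 1) * b x * b x := by
    rw [← eb1, ← Real.rpow_add_one hb0.ne']; ring_nf
  rw [show 1 - p - 1 = -p by ring, ea, ea1, eb, eb1]
  nlinarith [hsq]

theorem mul_rpow_sub_one_mul_sub_le_rpow {p s t : ℝ} (hp : 1 < p) (hs : 0 ≤ s) (ht : 0 ≤ t) :
    p * s ^ (p - 1) * t - (p - 1) * s ^ p ≤ t ^ p := by
  have hpq := Real.HolderConjugate.conjExponent hp
  have h := Real.young_inequality_of_nonneg ht (Real.rpow_nonneg hs (p - 1)) hpq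
  have hp1 : p - 1 ≠ 0 := by linarith
  have hp0 : 0 < p := by linarith
  rw [← Real.rpow_mul hs, Real.conjExponent, mul_div_cancel₀ _ hp1] at h
  have h' := mul_le_mul_of_nonneg_left h hp0.le
  have : p * (t ^ p / p + s ^ p / (p / (p - 1))) = t ^ p + (p - 1) * s ^ p := by
    field_simp
  linarith

theorem abs_rpow_sub_two_mul_self {s p : ℝ} (hp : 1 < p) (hs : s ≤ 0) :
    |s| ^ (p - 2) * s = -(-s) ^ (p - 1) := by
  rcases hs.eq_or_lt with rfl | hs
  · simp [Real.zero_rpow (by linarith : p - 1 ≠ 0)]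
  · rw [abs_of_neg hs, show p - 1 = p - 2 + 1 by ring, Real.rpow_add_one (by linarith)]
    ring

/-- A nonnegative `-Δ v` is positive when `Δ (W |Δ v| ^ (p - 2) Δ v)` is. -/
theorem elap_neg_of_elap_pos {n : ℕ} {Ω : Set (EuclideanSpace ℝ (Fin n))} (hΩ : IsOpen Ω)
    {p : ℝ} (hp : 1 < p) {W v : EuclideanSpace ℝ (Fin n) → ℝ} (hW : ContinuousOn W Ω)
    (hW0 : ∀ x ∈ Ω, 0 < W x) (hv : ContinuousOn (elap v) Ω)
    (hv0 : ∀ᵐ x ∂(volume.restrict Ω), 0 < -elap v x)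
    (hpos : ∀ x ∈ Ω, 0 < elap (fun y => W y * |elap v y| ^ (p - 2) * elap v y) x) :
    ∀ x ∈ Ω, elap v x < 0 := by
  have hle : ∀ x ∈ Ω, elap v x ≤ 0 := by
    intro x hx
    by_contra! h
    have hd := Measure.dense_of_ae ((ae_restrict_iff' hΩ.measurableSet).1 hv0)
    obtain ⟨y, hy, hyd⟩ := hd.inter_open_nonempty _ (hv.isOpen_inter_preimage hΩ isOpen_Ioi)
      ⟨x, hx, h⟩
    have h1 : 0 < elap v y := hy.2
    have h2 : 0 < -elap v y := hyd hy.1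
    linarith
  have hG : ∀ x ∈ Ω, W x * |elap v x| ^ (p - 2) * elap v x =
      -(W x * (-elap v x) ^ (p - 1)) := fun x hx => by
    rw [mul_assoc, abs_rpow_sub_two_mul_self hp (hle x hx)]
    ring
  intro x hx
  refine (hle x hx).lt_of_ne fun h => (hpos x hx).not_ge (elap_nonpos_of_isLocalMax ?_ ?_)
  · filter_upwards [hΩ.mem_nhds hx] with y hy
    have hy0 : 0 ≤ -elap v y := by linarith [hle y hy]
    have := hW0 y hy
    simp only [h, mul_zero, hG y hy]
    have : 0 ≤ W y * (-elap v y) ^ (p - 1) := by positivity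
    linarith
  · have hc : ContinuousOn (fun x => W x * |elap v x| ^ (p - 2) * elap v x) Ω := by
      refine ContinuousOn.congr ?_ hG
      exact (hW.mul (hv.neg.rpow_const fun _ _ => Or.inr (by linarith))).neg
    filter_upwards [hΩ.mem_nhds hx] with y hy
    exact hc.continuousAt (hΩ.mem_nhds hy)

/-- Pointwise bound in the regularized Picone inequality, with `a = u + ε v`, `s = v`. -/
theorem picone_bound {p a s w A D ε W : ℝ} (hp : 1 < p) (ha : 0 < a) (hs : 0 < s) (hw : 0 < w)
    (hW : 0 < W) (hε : 0 < ε)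
    (hD : p * (a ^ (p - 1) * s ^ (1 - p)) * A + (1 - p) * (a ^ p * s ^ (-p)) * (-w) +
      -ε ^ p * -w ≤ D) :
    -(W * w ^ (p - 1)) * D ≤ W * |A| ^ p := by
  have hwp : 0 < w ^ (p - 1) := by positivity
  have hy := mul_rpow_sub_one_mul_sub_le_rpow hp (s := a / s * w) (by positivity) (abs_nonneg A)
  have e1 : (a / s * w) ^ (p - 1) = a ^ (p - 1) * s ^ (1 - p) * w ^ (p - 1) := by
    rw [Real.mul_rpow (by positivity) hw.le, Real.div_rpow ha.le hs.le,
      show 1 - p = -(p - 1) by ring, Real.rpow_neg hs.le]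
    rfl
  have e2 : (a / s * w) ^ p = a ^ p * s ^ (-p) * (w ^ (p - 1) * w) := by
    rw [Real.mul_rpow (by positivity) hw.le, Real.div_rpow ha.le hs.le, Real.rpow_neg hs.le,
      ← Real.rpow_add_one hw.ne', sub_add_cancel]
    rfl
  rw [e1, e2] at hy
  have hD' := mul_le_mul_of_nonneg_left hD hwp.le
  have hε' : 0 < w ^ (p - 1) * (ε ^ p * w) := by positivity
  have hA : p * (a ^ (p - 1) * s ^ (1 - p) * w ^ (p - 1)) * -A ≤
      p * (a ^ (p - 1) * s ^ (1 - p) * w ^ (p - 1)) * |A| :=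
    mul_le_mul_of_nonneg_left (neg_le_abs A) (by positivity)
  have : -(w ^ (p - 1)) * D ≤ |A| ^ p := by linarith
  calc -(W * w ^ (p - 1)) * D = W * (-(w ^ (p - 1)) * D) := by ring
    _ ≤ W * |A| ^ p := mul_le_mul_of_nonneg_left this hW.le

theorem le_regularized_rpow {p a s ε : ℝ} (hp : 1 < p) (ha : 0 ≤ a) (hs : 0 < s) (hε : 0 < ε) :
    a ^ p ≤ s ^ (p - 1) * ((a + ε * s) ^ p * s ^ (1 - p) + -ε ^ p * s) := by
  have h := Real.add_rpow_le_rpow_add ha (by positivity : 0 ≤ ε * s) hp.le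
  rw [Real.mul_rpow hε.le hs.le] at h
  have e1 : s ^ (p - 1) * s ^ (1 - p) = 1 := by
    rw [← Real.rpow_add hs]; simp
  have e2 : s ^ (p - 1) * s = s ^ p := by
    rw [← Real.rpow_add_one hs.ne', sub_add_cancel]
  calc a ^ p ≤ (a + ε * s) ^ p * (s ^ (p - 1) * s ^ (1 - p)) - ε ^ p * (s ^ (p - 1) * s) := by
        rw [e1, e2]; linarith
    _ = _ := by ring

theorem regularized_rpow_eq_zero {p s ε : ℝ} (hs : 0 < s) (hε : 0 < ε) :
    (0 + ε * s) ^ p * s ^ (1 - p) + -ε ^ p * s = 0 := by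
  have : s ^ p * s ^ (1 - p) = s := by rw [← Real.rpow_add hs]; simp
  rw [zero_add, Real.mul_rpow hε.le hs.le, mul_assoc, this]
  ring

/-- The Rellich inequality with the test function perturbed by a multiple of the supersolution. -/
theorem rellich_perturbed {n : ℕ} {Ω : Set (EuclideanSpace ℝ (Fin n))}
    (hΩ : IsOpen Ω) {p : ℝ} (hp : 1 < p) {W H v u : EuclideanSpace ℝ (Fin n) → ℝ}
    (hW : ContDiffOn ℝ 2 W Ω) (hW0 : ∀ x ∈ Ω, 0 < W x) (hH0 : ∀ x ∈ Ω, 0 < H x)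
    (hv : ContDiffOn ℝ 4 v Ω) (hv0 : ∀ x ∈ Ω, 0 < v x) (hlap : ∀ x ∈ Ω, elap v x < 0)
    (hsup : ∀ x ∈ Ω,
      H x * v x ^ (p - 1) ≤ elap (fun y => W y * |elap v y| ^ (p - 2) * elap v y) x)
    (hu : ContDiff ℝ 2 u) (hucs : HasCompactSupport u) (husupp : tsupport u ⊆ Ω)
    (hu0 : ∀ x, 0 ≤ u x) {ε : ℝ} (hε : 0 < ε) :
    ∫ x in Ω, H x * u x ^ p ≤ ∫ x in tsupport u, W x * |elap u x + ε * elap v x| ^ p := by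
  have hK : IsCompact (tsupport u) := hucs
  have hv2 : ContDiffOn ℝ 2 v Ω := hv.of_le (by norm_num)
  have hL : ContDiffOn ℝ 2 (elap v) Ω :=
    contDiffOn_elap (l := 3) hv hΩ (by norm_num) (by norm_num)
  have hLu : ContDiffOn ℝ 0 (elap u) Ω :=
    contDiffOn_elap (l := 1) hu.contDiffOn hΩ (by norm_num) (by norm_num)
  set g : EuclideanSpace ℝ (Fin n) → ℝ := fun y => W y * |elap v y| ^ (p - 2) * elap v y
  have hgeq : ∀ x ∈ Ω, g x = -(W x * (-elap v x) ^ (p - 1)) := fun x hx => by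
    simp only [g]
    rw [mul_assoc, abs_rpow_sub_two_mul_self hp (hlap x hx).le]
    ring
  have hg : ContDiffOn ℝ 2 g Ω := by
    refine ContDiffOn.congr ?_ hgeq
    exact (hW.mul (hL.neg.rpow_const_of_ne fun x hx => (neg_pos.2 (hlap x hx)).ne')).neg
  have ha0 : ∀ x ∈ Ω, 0 < u x + ε * v x := fun x hx =>
    add_pos_of_nonneg_of_pos (hu0 x) (mul_pos hε (hv0 x hx))
  have ha : ContDiffOn ℝ 2 (fun x => u x + ε * v x) Ω :=
    hu.contDiffOn.add (contDiffOn_const.mul hv2)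
  have hab : ContDiffOn ℝ 2 (fun x => (u x + ε * v x) ^ p * v x ^ (1 - p)) Ω :=
    (ha.rpow_const_of_ne fun x hx => (ha0 x hx).ne').mul
      (hv2.rpow_const_of_ne fun x hx => (hv0 x hx).ne')
  set φ : EuclideanSpace ℝ (Fin n) → ℝ :=
    fun x => (u x + ε * v x) ^ p * v x ^ (1 - p) + -ε ^ p * v x
  have hφ : ContDiffOn ℝ 2 φ Ω := hab.add (contDiffOn_const.mul hv2)
  have hφ0 : ∀ x ∈ Ω \ tsupport u, φ x = 0 := fun x hx => by
    simp only [φ, image_eq_zero_of_notMem_tsupport hx.2]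
    exact regularized_rpow_eq_zero (hv0 x hx.1) hε
  have hLφ0 : ∀ x ∈ Ω \ tsupport u, elap φ x = 0 := fun x hx => by
    have : φ =ᶠ[𝓝 x] fun _ => 0 :=
      eventually_of_mem ((hΩ.sdiff hK.isClosed).mem_nhds hx) hφ0
    rw [elap_congr this, elap_zero]
  have hLφ : ContDiffOn ℝ 0 (elap φ) Ω :=
    contDiffOn_elap (l := 1) hφ hΩ (by norm_num) (by norm_num)
  have hLg : ContDiffOn ℝ 0 (elap g) Ω :=
    contDiffOn_elap (l := 1) hg hΩ (by norm_num) (by norm_num)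
  calc ∫ x in Ω, H x * u x ^ p ≤ ∫ x in Ω, φ x * elap g x := by
        refine integral_mono_of_nonneg ?_ ?_ ?_
        · filter_upwards [ae_restrict_mem hΩ.measurableSet] with x hx
          exact mul_nonneg (hH0 x hx).le (Real.rpow_nonneg (hu0 x) p)
        · exact integrableOn_of_continuousOn_of_eq_zero hΩ.measurableSet hK husupp
            (hφ.continuousOn.mul hLg.continuousOn) fun x hx => by simp [hφ0 x hx]
        · filter_upwards [ae_restrict_mem hΩ.measurableSet] with x hx
          have h1 : u x ^ p ≤ v x ^ (p - 1) * φ x :=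
            le_regularized_rpow hp (hu0 x) (hv0 x hx) hε
          have hvp : 0 < v x ^ (p - 1) := Real.rpow_pos_of_pos (hv0 x hx) _
          have hφn : 0 ≤ φ x :=
            nonneg_of_mul_nonneg_right ((Real.rpow_nonneg (hu0 x) p).trans h1) hvp
          calc H x * u x ^ p ≤ H x * (v x ^ (p - 1) * φ x) :=
                mul_le_mul_of_nonneg_left h1 (hH0 x hx).le
            _ = φ x * (H x * v x ^ (p - 1)) := by ring
            _ ≤ φ x * elap g x := mul_le_mul_of_nonneg_left (hsup x hx) hφn
    _ = ∫ x in Ω, g x * elap φ x := setIntegral_mul_elap_comm hΩ hK husupp hφ hg hφ0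
    _ = ∫ x in tsupport u, g x * elap φ x :=
        (setIntegral_eq_of_subset_of_forall_sdiff_eq_zero hΩ.measurableSet husupp
          fun x hx => by simp [hLφ0 x hx])
    _ ≤ ∫ x in tsupport u, W x * |elap u x + ε * elap v x| ^ p := by
        refine setIntegral_mono_on ?_ ?_ hK.measurableSet fun x hx => ?_
        · exact ((hg.continuousOn.mul hLφ.continuousOn).mono husupp).integrableOn_compact hK
        · refine ((hW.continuousOn.mul (ContinuousOn.rpow_const ?_ fun _ _ =>
            Or.inr (by linarith))).mono husupp).integrableOn_compact hK
          exact (hLu.continuousOn.add (continuousOn_const.mul hL.continuousOn)).abs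
        · have hxΩ := husupp hx
          have hn := hΩ.mem_nhds hxΩ
          have hvx := hv2.contDiffAt hn
          have hle := le_elap_rpow_mul_rpow hp (ha.contDiffAt hn) hvx (ha0 x hxΩ) (hv0 x hxΩ)
          have hD : elap φ x = _ := elap_add_const_mul (hab.contDiffAt hn) hvx (-ε ^ p)
          rw [elap_add_const_mul hu.contDiffAt hvx] at hle
          rw [hgeq x hxΩ]
          refine picone_bound hp (ha0 x hxΩ) (hv0 x hxΩ) (neg_pos.2 (hlap x hxΩ)) (hW0 x hxΩ)
            hε ?_
          rw [hD, neg_neg]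
          linarith

/-- `L^p` Rellich inequality with a Bessel pair: if `1 < p < n`, `v > 0`, `−Δv > 0` a.e.,
and `Δ(W|Δv|^{p−2}Δv) ≥ H v^{p−1}`, then `∫_Ω W|Δu|^p ≥ ∫_Ω H u^p` for
nonnegative `u ∈ C²_c(Ω)`. -/
theorem rellich_bessel_pair_p {n : ℕ} (Ω : Set (EuclideanSpace ℝ (Fin n)))
    (hΩo : IsOpen Ω) (hΩc : IsConnected Ω) (hΩb : Bornology.IsBounded Ω)
    (p : ℝ) (hp : 1 < p) (hpn : p < n)
    (W H v : EuclideanSpace ℝ (Fin n) → ℝ)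
    (hW : ContDiffOn ℝ 2 W Ω) (hWpos : ∀ x ∈ Ω, 0 < W x)
    (hH : LocallyIntegrableOn H Ω) (hHpos : ∀ x ∈ Ω, 0 < H x)
    (hv : ContDiffOn ℝ 4 v Ω) (hvpos : ∀ x ∈ Ω, 0 < v x)
    (hvlap : ∀ᵐ x ∂(volume.restrict Ω), 0 < -elap v x)
    (hsup : ∀ x ∈ Ω,
      H x * v x ^ (p - 1) ≤ elap (fun y => W y * |elap v y| ^ (p - 2) * elap v y) x)
    (u : EuclideanSpace ℝ (Fin n) → ℝ)
    (hu : ContDiff ℝ 2 u) (hucs : HasCompactSupport u) (husupp : tsupport u ⊆ Ω)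
    (hu0 : ∀ x, 0 ≤ u x) :
    ∫ x in Ω, H x * u x ^ p ≤ ∫ x in Ω, W x * |elap u x| ^ p := by
  have hK : IsCompact (tsupport u) := hucs
  have hp0 : 0 ≤ p := by linarith
  have hL : ContinuousOn (elap v) Ω :=
    (contDiffOn_elap (m := 2) (l := 3) hv hΩo (by norm_num) (by norm_num)).continuousOn
  have hLu : ContinuousOn (elap u) Ω :=
    (contDiffOn_elap (m := 0) (l := 1) hu.contDiffOn hΩo (by norm_num)
      (by norm_num)).continuousOn
  have hlap := elap_neg_of_elap_pos hΩo hp hW.continuousOn hWpos hL hvlap fun x hx =>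
    (mul_pos (hHpos x hx) (Real.rpow_pos_of_pos (hvpos x hx) _)).trans_le (hsup x hx)
  have hlim : Tendsto (fun ε : ℝ => ∫ x in tsupport u, W x * |elap u x + ε * elap v x| ^ p)
      (𝓝[>] 0) (𝓝 (∫ x in tsupport u, W x * |elap u x| ^ p)) := by
    refine tendsto_integral_filter_of_dominated_convergence
      (fun x => W x * (|elap u x| + |elap v x|) ^ p) (Eventually.of_forall fun ε => ?_) ?_ ?_ ?_
    · refine ((hW.continuousOn.mul (ContinuousOn.rpow_const ?_ fun _ _ =>
        Or.inr hp0)).mono husupp).aestronglyMeasurable hK.measurableSet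
      exact (hLu.add (continuousOn_const.mul hL)).abs
    · filter_upwards [Ioo_mem_nhdsGT one_pos] with ε hε
      filter_upwards [ae_restrict_mem hK.measurableSet] with x hx
      have hWx := hWpos x (husupp hx)
      rw [Real.norm_of_nonneg (by positivity)]
      have h1 : |elap u x + ε * elap v x| ≤ |elap u x| + |elap v x| := by
        refine (abs_add_le _ _).trans (add_le_add le_rfl ?_)
        rw [abs_mul, abs_of_pos hε.1]
        exact mul_le_of_le_one_left (abs_nonneg _) hε.2.le
      gcongr
    · exact ((hW.continuousOn.mul ((hLu.abs.add hL.abs).rpow_const fun _ _ =>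
        Or.inr hp0)).mono husupp).integrableOn_compact hK
    · refine Eventually.of_forall fun x => ?_
      have hc : Continuous fun ε : ℝ => W x * |elap u x + ε * elap v x| ^ p :=
        continuous_const.mul (Continuous.rpow_const (by fun_prop) fun _ => Or.inr hp0)
      simpa using (hc.tendsto 0).mono_left nhdsWithin_le_nhds
  have hzero : ∀ x ∈ Ω \ tsupport u, W x * |elap u x| ^ p = 0 := fun x hx => by
    rw [elap_congr (notMem_tsupport_iff_eventuallyEq.1 hx.2)]
    change W x * |elap (fun _ => 0) x| ^ p = 0
    simp [elap_zero, Real.zero_rpow (by linarith : p ≠ 0)]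
  rw [setIntegral_eq_of_subset_of_forall_sdiff_eq_zero hΩo.measurableSet husupp hzero]
  refine ge_of_tendsto hlim ?_
  filter_upwards [self_mem_nhdsWithin] with ε hε
  exact rellich_perturbed hΩo hp hW hWpos hHpos hv hvpos hlap hsup hu hucs husupp hu0 hε
end

section
/- Let n ≥ 3 and 1 < p < n/2. Then for all real-valued u ∈ C^∞_c(ℝⁿ \ {0}), ∫_{ℝⁿ} |Δu|^p dx ≥ (n/p − 2)^p (n(p−1)/p)^p ∫_{ℝⁿ} |x|^{−2p} |u|^p dx. -/
open MeasureTheory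

section Calculus

variable {n : ℕ}

theorem integral_fderiv_apply_eq_zero_s19 {F : EuclideanSpace ℝ (Fin n) → ℝ} (hF : ContDiff ℝ 1 F)
    (hc : HasCompactSupport F) (v : EuclideanSpace ℝ (Fin n)) :
    Integrable (fun x => fderiv ℝ F x v) ∧ ∫ x, fderiv ℝ F x v = 0 := by
  have hi : Integrable (fun x => fderiv ℝ F x v) :=
    ((hF.continuous_fderiv one_ne_zero).clm_apply continuous_const).integrable_of_hasCompactSupport
      (hc.fderiv_apply (𝕜 := ℝ) v)
  refine ⟨hi, ?_⟩
  have h := integral_mul_fderiv_eq_neg_fderiv_mul_of_integrable (𝕜 := ℝ) (μ := volume)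
    (f := fun _ : EuclideanSpace ℝ (Fin n) => (1 : ℝ)) (g := F) (v := v)
    (by simp) (by simpa using hi)
    (by simpa using hF.continuous.integrable_of_hasCompactSupport hc)
    (fun x _ => by fun_prop) (fun x _ => (hF.differentiable one_ne_zero) x)
  simpa using h

theorem hasFDerivAt_norm_sq_rpow {x : EuclideanSpace ℝ (Fin n)} (hx : x ≠ 0) (a : ℝ) :
    HasFDerivAt (fun y : EuclideanSpace ℝ (Fin n) => (‖y‖ ^ 2) ^ a)
      ((a * (‖x‖ ^ 2) ^ (a - 1)) • (2 • innerSL ℝ x)) x :=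
  (hasStrictFDerivAt_norm_sq x).hasFDerivAt.rpow_const (Or.inl (by positivity))

theorem contDiffAt_norm_sq_rpow {x : EuclideanSpace ℝ (Fin n)} (hx : x ≠ 0) (a : ℝ) :
    ContDiffAt ℝ 1 (fun y : EuclideanSpace ℝ (Fin n) => (‖y‖ ^ 2) ^ a) x :=
  (contDiff_norm_sq ℝ).contDiffAt.rpow_const_of_ne (by positivity)

theorem hasCompactSupport_of_eq_zero_off {u f : EuclideanSpace ℝ (Fin n) → ℝ}
    (hucs : HasCompactSupport u) (hf : ∀ x ∉ tsupport u, f x = 0) :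
    HasCompactSupport f ∧ tsupport f ⊆ tsupport u := by
  refine ⟨HasCompactSupport.intro hucs hf, closure_minimal ?_ (isClosed_tsupport u)⟩
  intro x hx
  by_contra h
  exact hx (hf x h)

theorem integrable_norm_sq_rpow_mul {u g : EuclideanSpace ℝ (Fin n) → ℝ}
    (hucs : HasCompactSupport u) (h0 : tsupport u ⊆ {(0 : EuclideanSpace ℝ (Fin n))}ᶜ)
    (hg : Continuous g) (hgu : ∀ x ∉ tsupport u, g x = 0) (a : ℝ) :
    Integrable (fun x => (‖x‖ ^ 2) ^ a * g x) := by
  obtain ⟨hc, ht⟩ := hasCompactSupport_of_eq_zero_off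
    (f := fun x => (‖x‖ ^ 2) ^ a * g x) hucs (fun x hx => by simp [hgu x hx])
  refine Continuous.integrable_of_hasCompactSupport ?_ hc
  refine continuous_of_tsupport fun x hx => ?_
  exact (contDiffAt_norm_sq_rpow (h0 (ht hx)) a).continuousAt.mul hg.continuousAt

theorem elap_eq_zero_of_notMem_tsupport {u : EuclideanSpace ℝ (Fin n) → ℝ}
    {x : EuclideanSpace ℝ (Fin n)} (hx : x ∉ tsupport u) : elap u x = 0 := by
  refine Finset.sum_eq_zero fun i _ => ?_
  have : x ∉ tsupport (fun y => fderiv ℝ u y (EuclideanSpace.single i 1)) := fun h =>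
    hx (tsupport_fderiv_apply_subset ℝ _ h)
  rw [fderiv_of_notMem_tsupport ℝ this]
  simp

theorem contDiff_fderiv_apply {u : EuclideanSpace ℝ (Fin n) → ℝ}
    (hu : ContDiff ℝ (⊤ : ℕ∞) u) (v : EuclideanSpace ℝ (Fin n)) :
    ContDiff ℝ 1 (fun y => fderiv ℝ u y v) := by
  have : ContDiff ℝ 2 u := hu.of_le (WithTop.coe_le_coe.2 (le_top : (2 : ℕ∞) ≤ ⊤))
  exact (this.fderiv_right (m := 1) (by norm_num [one_add_one_eq_two])).clm_apply contDiff_const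

theorem continuous_elap {u : EuclideanSpace ℝ (Fin n) → ℝ}
    (hu : ContDiff ℝ (⊤ : ℕ∞) u) : Continuous (elap u) :=
  continuous_finsetSum _ fun _ _ =>
    ((contDiff_fderiv_apply hu _).continuous_fderiv one_ne_zero).clm_apply continuous_const

theorem gradient_square_bound {N V k c t : ℝ} (g y : Fin n → ℝ) (hN : N = ∑ i, y i ^ 2)
    (hN0 : 0 < N) (hV : 0 ≤ V) (hk : 0 ≤ k) :
    -(c ^ 2 * V * k * t ^ 2) ≤
      V * N * k * ∑ i, g i ^ 2 + 2 * c * V * k * t * ∑ i, y i * g i := by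
  have h : 0 ≤ ∑ i, (N * g i + c * t * y i) ^ 2 := Finset.sum_nonneg fun i _ => sq_nonneg _
  have e : ∑ i, (N * g i + c * t * y i) ^ 2
      = N ^ 2 * ∑ i, g i ^ 2 + 2 * N * c * t * ∑ i, y i * g i + c ^ 2 * t ^ 2 * ∑ i, y i ^ 2 := by
    simp only [Finset.mul_sum, ← Finset.sum_add_distrib]
    exact Finset.sum_congr rfl fun i _ => by ring
  rw [e, ← hN] at h
  have h2 : 0 ≤ N * ∑ i, g i ^ 2 + 2 * c * t * ∑ i, y i * g i + c ^ 2 * t ^ 2 := by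
    refine nonneg_of_mul_nonneg_right (a := N) ?_ hN0
    linarith
  have := mul_nonneg (mul_nonneg hV hk) h2
  linarith

theorem fderiv_weighted_field_apply {u : EuclideanSpace ℝ (Fin n) → ℝ}
    {φ φ' E e : ℝ → ℝ} {p : ℝ} {x : EuclideanSpace ℝ (Fin n)}
    (hu : ContDiff ℝ (⊤ : ℕ∞) u) (hφ : ∀ t, HasDerivAt φ (φ' t) t)
    (hE : ∀ t : ℝ, HasDerivAt E (e t) t) (hx : x ≠ 0) (i : Fin n) :
    fderiv ℝ (fun y : EuclideanSpace ℝ (Fin n) =>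
        (‖y‖ ^ 2) ^ (1 - p) * (φ (u y) * fderiv ℝ u y (EuclideanSpace.single i 1))
          - (‖y‖ ^ 2) ^ (-p) * (y i * E (u y))) x (EuclideanSpace.single i 1)
      = (1 - p) * (‖x‖ ^ 2) ^ (-p) * (2 * x i)
            * (φ (u x) * fderiv ℝ u x (EuclideanSpace.single i 1))
        + (‖x‖ ^ 2) ^ (1 - p) * (φ' (u x) * fderiv ℝ u x (EuclideanSpace.single i 1) ^ 2
            + φ (u x) * fderiv ℝ (fun y => fderiv ℝ u y (EuclideanSpace.single i 1)) x
              (EuclideanSpace.single i 1))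
        + p * (‖x‖ ^ 2) ^ (-p - 1) * (2 * x i) * (x i * E (u x))
        - (‖x‖ ^ 2) ^ (-p) * (E (u x)
            + x i * (e (u x) * fderiv ℝ u x (EuclideanSpace.single i 1))) := by
  have du : HasFDerivAt u (fderiv ℝ u x) x :=
    (hu.differentiable (by simp) x).hasFDerivAt
  have d2u := (((contDiff_fderiv_apply hu (EuclideanSpace.single i 1)).differentiable
    one_ne_zero) x).hasFDerivAt
  have dx : HasFDerivAt (fun y : EuclideanSpace ℝ (Fin n) => y i)
      (EuclideanSpace.proj i : EuclideanSpace ℝ (Fin n) →L[ℝ] ℝ) x :=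
    (EuclideanSpace.proj i : EuclideanSpace ℝ (Fin n) →L[ℝ] ℝ).hasFDerivAt
  have h := ((hasFDerivAt_norm_sq_rpow hx (1 - p)).mul
    (((hφ (u x)).comp_hasFDerivAt x du).mul d2u)).sub
    ((hasFDerivAt_norm_sq_rpow hx (-p)).mul (dx.mul ((hE (u x)).comp_hasFDerivAt x du)))
  have h' := congrArg (fun L : EuclideanSpace ℝ (Fin n) →L[ℝ] ℝ => L (EuclideanSpace.single i 1))
    h.fderiv
  refine Eq.trans h' ?_
  have e1 : (1 - p - 1 : ℝ) = -p := by ring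
  simp [e1, EuclideanSpace.inner_single_right]
  ring

theorem integral_weighted_mul_elap_le {u : EuclideanSpace ℝ (Fin n) → ℝ}
    {φ φ' E : ℝ → ℝ} {p c : ℝ}
    (hu : ContDiff ℝ (⊤ : ℕ∞) u) (hucs : HasCompactSupport u)
    (h0 : tsupport u ⊆ {(0 : EuclideanSpace ℝ (Fin n))}ᶜ)
    (hφ : ∀ t, HasDerivAt φ (φ' t) t) (hφ' : Continuous φ') (hφ'0 : ∀ t, 0 ≤ φ' t)
    (hE : ∀ t, HasDerivAt E ((2 - 2 * p) * φ t - 2 * c * φ' t * t) t) (hE0 : E 0 = 0) :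
    ∫ x, (‖x‖ ^ 2) ^ (1 - p) * (φ (u x) * elap u x)
      ≤ ∫ x, (‖x‖ ^ 2) ^ (-p) * (c ^ 2 * φ' (u x) * u x ^ 2 + (n - 2 * p) * E (u x)) := by
  have cu : Continuous u := hu.continuous
  have cφ : Continuous φ := continuous_iff_continuousAt.2 fun t => (hφ t).continuousAt
  have cE : Continuous E := continuous_iff_continuousAt.2 fun t => (hE t).continuousAt
  have hu1 : ContDiff ℝ 1 u := hu.of_le (mod_cast (le_top : (1 : ℕ∞) ≤ ⊤))
  have c1φ : ContDiff ℝ 1 φ := contDiff_one_iff_deriv.2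
    ⟨fun t => (hφ t).differentiableAt, by rwa [funext fun t => (hφ t).deriv]⟩
  have c1E : ContDiff ℝ 1 E := contDiff_one_iff_deriv.2
    ⟨fun t => (hE t).differentiableAt, by
      rw [funext fun t => (hE t).deriv]; fun_prop⟩
  have u0 : ∀ x ∉ tsupport u, u x = 0 := fun x hx => image_eq_zero_of_notMem_tsupport hx
  have du0 : ∀ x ∉ tsupport u, fderiv ℝ u x = 0 := fun x hx => fderiv_of_notMem_tsupport ℝ hx
  set F : Fin n → EuclideanSpace ℝ (Fin n) → ℝ := fun i y =>
    (‖y‖ ^ 2) ^ (1 - p) * (φ (u y) * fderiv ℝ u y (EuclideanSpace.single i 1))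
          - (‖y‖ ^ 2) ^ (-p) * (y i * E (u y)) with hF
  have Fsupp (i) := hasCompactSupport_of_eq_zero_off (f := F i) hucs
    (fun x hx => by simp [hF, u0 x hx, du0 x hx, hE0])
  have Fsmooth (i) : ContDiff ℝ 1 (F i) := by
    refine contDiff_iff_contDiffAt.2 fun x => ?_
    by_cases hx : x ∈ tsupport (F i)
    swap
    · exact contDiffAt_const.congr_of_eventuallyEq (notMem_tsupport_iff_eventuallyEq.1 hx)
    have hx0 : x ≠ 0 := h0 ((Fsupp i).2 hx)
    exact ((contDiffAt_norm_sq_rpow hx0 _).mul ((c1φ.comp hu1).contDiffAt.mul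
      (contDiff_fderiv_apply hu _).contDiffAt)).sub ((contDiffAt_norm_sq_rpow hx0 _).mul
      ((EuclideanSpace.proj i : EuclideanSpace ℝ (Fin n) →L[ℝ] ℝ).contDiff.contDiffAt.mul
        (c1E.comp hu1).contDiffAt))
  have Fint (i) := integral_fderiv_apply_eq_zero_s19 (Fsmooth i) (Fsupp i).1
    (EuclideanSpace.single i 1)
  have hdivI : Integrable (fun x => ∑ i, fderiv ℝ (F i) x (EuclideanSpace.single i 1)) :=
    integrable_finsetSum _ fun i _ => (Fint i).1
  have hdiv : ∫ x, ∑ i, fderiv ℝ (F i) x (EuclideanSpace.single i 1) = 0 := by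
    rw [integral_finsetSum _ fun i _ => (Fint i).1]
    exact Finset.sum_eq_zero fun i _ => (Fint i).2
  have hL : Integrable (fun x => (‖x‖ ^ 2) ^ (1 - p) * (φ (u x) * elap u x)) :=
    integrable_norm_sq_rpow_mul hucs h0 ((cφ.comp cu).mul (continuous_elap hu))
      (fun x hx => by simp [elap_eq_zero_of_notMem_tsupport hx]) _
  have hR : Integrable (fun x => (‖x‖ ^ 2) ^ (-p) *
      (c ^ 2 * φ' (u x) * u x ^ 2 + (n - 2 * p) * E (u x))) :=
    integrable_norm_sq_rpow_mul hucs h0 (by fun_prop)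
      (fun x hx => by simp [u0 x hx, hE0]) _
  have key : ∫ x, (‖x‖ ^ 2) ^ (1 - p) * (φ (u x) * elap u x)
      ≤ ∫ x, ((‖x‖ ^ 2) ^ (-p) * (c ^ 2 * φ' (u x) * u x ^ 2 + (n - 2 * p) * E (u x))
        + ∑ i, fderiv ℝ (F i) x (EuclideanSpace.single i 1)) := by
    refine integral_mono hL (hR.add hdivI) fun x => ?_
    by_cases hx : x ∈ tsupport u
    swap
    · have : ∀ i, fderiv ℝ (F i) x = 0 := fun i =>
        fderiv_of_notMem_tsupport ℝ fun h => hx ((Fsupp i).2 h)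
      simp [this, elap_eq_zero_of_notMem_tsupport hx, u0 x hx, hE0]
    have hx0 : x ≠ 0 := h0 hx
    have hN0 : 0 < ‖x‖ ^ 2 := by positivity
    have hN : ‖x‖ ^ 2 = ∑ i, x i ^ 2 := EuclideanSpace.real_norm_sq_eq x
    have e1 : (‖x‖ ^ 2) ^ (1 - p) = (‖x‖ ^ 2) ^ (-p) * ‖x‖ ^ 2 := by
      rw [← Real.rpow_add_one hN0.ne']; ring_nf
    have e2 : (‖x‖ ^ 2) ^ (-p - 1) * ‖x‖ ^ 2 = (‖x‖ ^ 2) ^ (-p) := by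
      rw [← Real.rpow_add_one hN0.ne']; ring_nf
    have hsq := gradient_square_bound (c := c) (t := u x)
      (fun i => fderiv ℝ u x (EuclideanSpace.single i 1)) (fun i => x i) hN hN0
      (Real.rpow_nonneg hN0.le (-p)) (hφ'0 (u x))
    have hsum : ∑ i, fderiv ℝ (F i) x (EuclideanSpace.single i 1)
        = (‖x‖ ^ 2) ^ (1 - p) * φ' (u x)
            * ∑ i, fderiv ℝ u x (EuclideanSpace.single i 1) ^ 2
          + (‖x‖ ^ 2) ^ (1 - p) * φ (u x) * elap u x
          + 2 * c * (‖x‖ ^ 2) ^ (-p) * φ' (u x) * u x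
            * ∑ i, x i * fderiv ℝ u x (EuclideanSpace.single i 1)
          + 2 * p * E (u x) * (‖x‖ ^ 2) ^ (-p - 1) * ∑ i, x i ^ 2
          - n * ((‖x‖ ^ 2) ^ (-p) * E (u x)) := by
      have hn : (n : ℝ) * ((‖x‖ ^ 2) ^ (-p) * E (u x))
          = ∑ _i : Fin n, (‖x‖ ^ 2) ^ (-p) * E (u x) := by simp
      rw [hn]
      simp only [hF, elap, fderiv_weighted_field_apply hu hφ hE hx0, Finset.mul_sum,
        ← Finset.sum_add_distrib, ← Finset.sum_sub_distrib]
      exact Finset.sum_congr rfl fun i _ => by ring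
    have e3 : 2 * p * E (u x) * (‖x‖ ^ 2) ^ (-p - 1) * ∑ i, x i ^ 2
        = 2 * p * E (u x) * (‖x‖ ^ 2) ^ (-p) := by
      rw [← e2, ← hN]; ring
    simp only [hsum, e3]
    rw [e1]
    linarith
  rwa [integral_add hR hdivI, hdiv, add_zero] at key

theorem integral_abs_elap_rpow_regularized {u : EuclideanSpace ℝ (Fin n) → ℝ}
    {φ φ' E : ℝ → ℝ} {p q c C : ℝ} (hpq : p.HolderConjugate q) (hC : 0 ≤ C)
    (hu : ContDiff ℝ (⊤ : ℕ∞) u) (hucs : HasCompactSupport u)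
    (h0 : tsupport u ⊆ {(0 : EuclideanSpace ℝ (Fin n))}ᶜ)
    (hφ : ∀ t, HasDerivAt φ (φ' t) t) (hφ' : Continuous φ') (hφ'0 : ∀ t, 0 ≤ φ' t)
    (hφ0 : φ 0 = 0)
    (hE : ∀ t, HasDerivAt E ((2 - 2 * p) * φ t - 2 * c * φ' t * t) t) (hE0 : E 0 = 0) :
    0 ≤ (∫ x, |elap u x| ^ p) / p + ∫ x, (‖x‖ ^ 2) ^ (-p) * (C ^ p / q * |φ (u x)| ^ q
      + C ^ (p - 1) * (c ^ 2 * φ' (u x) * u x ^ 2 + (n - 2 * p) * E (u x))) := by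
  have cu : Continuous u := hu.continuous
  have cφ : Continuous φ := continuous_iff_continuousAt.2 fun t => (hφ t).continuousAt
  have cE : Continuous E := continuous_iff_continuousAt.2 fun t => (hE t).continuousAt
  have u0 : ∀ x ∉ tsupport u, u x = 0 := fun x hx => image_eq_zero_of_notMem_tsupport hx
  have cΔ := continuous_elap hu
  have hL : Integrable (fun x => (‖x‖ ^ 2) ^ (1 - p) * (φ (u x) * elap u x)) :=
    integrable_norm_sq_rpow_mul hucs h0 ((cφ.comp cu).mul cΔ)
      (fun x hx => by simp [elap_eq_zero_of_notMem_tsupport hx]) _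
  have hR : Integrable (fun x => (‖x‖ ^ 2) ^ (-p) *
      (c ^ 2 * φ' (u x) * u x ^ 2 + (n - 2 * p) * E (u x))) :=
    integrable_norm_sq_rpow_mul hucs h0 (by fun_prop)
      (fun x hx => by simp [u0 x hx, hE0]) _
  have hJ : Integrable (fun x => |elap u x| ^ p) := by
    have hcont : Continuous (fun x => |elap u x| ^ p) :=
      cΔ.abs.rpow_const fun _ => Or.inr hpq.pos.le
    refine hcont.integrable_of_hasCompactSupport (hasCompactSupport_of_eq_zero_off hucs ?_).1
    intro x hx
    simp [elap_eq_zero_of_notMem_tsupport hx, hpq.ne_zero]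
  have hQ : Integrable (fun x => (‖x‖ ^ 2) ^ (-p) * |φ (u x)| ^ q) :=
    integrable_norm_sq_rpow_mul hucs h0
      ((cφ.comp cu).abs.rpow_const fun _ => Or.inr hpq.symm.pos.le)
      (fun x hx => by simp [u0 x hx, hφ0, hpq.symm.ne_zero]) _
  have key := integral_weighted_mul_elap_le hu hucs h0 hφ hφ' hφ'0 hE hE0
  have young : ∫ x, -(C ^ (p - 1) * ((‖x‖ ^ 2) ^ (1 - p) * (φ (u x) * elap u x)))
      ≤ ∫ x, (|elap u x| ^ p / p + C ^ p / q * ((‖x‖ ^ 2) ^ (-p) * |φ (u x)| ^ q)) := by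
    refine integral_mono (hL.const_mul _).neg ((hJ.div_const p).add (hQ.const_mul _)) fun x => ?_
    have hN : 0 ≤ ‖x‖ ^ 2 := by positivity
    have h1 : 0 ≤ C ^ (p - 1) * (‖x‖ ^ 2) ^ (1 - p) := by positivity
    have y := Real.young_inequality_of_nonneg (abs_nonneg (elap u x))
      (mul_nonneg h1 (abs_nonneg (φ (u x)))) hpq
    have e : (C ^ (p - 1) * (‖x‖ ^ 2) ^ (1 - p) * |φ (u x)|) ^ q
        = C ^ p * ((‖x‖ ^ 2) ^ (-p) * |φ (u x)| ^ q) := by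
      have e1 : (p - 1) * q = p := hpq.sub_one_mul_conj
      have e2 : (1 - p) * q = -p := by linarith
      rw [Real.mul_rpow h1 (abs_nonneg _), Real.mul_rpow (by positivity) (by positivity),
        ← Real.rpow_mul hC, ← Real.rpow_mul hN, e1, e2, mul_assoc]
    have a := neg_le_abs (C ^ (p - 1) * ((‖x‖ ^ 2) ^ (1 - p) * (φ (u x) * elap u x)))
    have a' : |C ^ (p - 1) * ((‖x‖ ^ 2) ^ (1 - p) * (φ (u x) * elap u x))|
        = |elap u x| * (C ^ (p - 1) * (‖x‖ ^ 2) ^ (1 - p) * |φ (u x)|) := by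
      rw [← mul_assoc, abs_mul, abs_of_nonneg h1, abs_mul]; ring
    rw [e] at y
    rw [a'] at a
    refine a.trans (y.trans (le_of_eq ?_))
    ring
  rw [integral_neg, integral_const_mul, integral_add (hJ.div_const p) (hQ.const_mul _),
    integral_div, integral_const_mul] at young
  have key' := mul_le_mul_of_nonneg_left key (Real.rpow_nonneg hC (p - 1))
  have split : ∫ x, (‖x‖ ^ 2) ^ (-p) * (C ^ p / q * |φ (u x)| ^ q
      + C ^ (p - 1) * (c ^ 2 * φ' (u x) * u x ^ 2 + (n - 2 * p) * E (u x)))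
      = C ^ p / q * (∫ x, (‖x‖ ^ 2) ^ (-p) * |φ (u x)| ^ q)
        + C ^ (p - 1) * ∫ x, (‖x‖ ^ 2) ^ (-p) *
          (c ^ 2 * φ' (u x) * u x ^ 2 + (n - 2 * p) * E (u x)) := by
    rw [← integral_const_mul, ← integral_const_mul,
      ← integral_add (hQ.const_mul _) (hR.const_mul _)]
    congr 1; ext x; ring
  rw [split]
  linarith

theorem tendsto_integral_weighted_comp {u : EuclideanSpace ℝ (Fin n) → ℝ}
    {A : ℝ → ℝ → ℝ} {A₀ : ℝ → ℝ} (a : ℝ)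
    (hu : Continuous u) (hucs : HasCompactSupport u)
    (h0 : tsupport u ⊆ {(0 : EuclideanSpace ℝ (Fin n))}ᶜ)
    (hA : ∀ ε > 0, Continuous (A ε)) (hA0 : ∀ ε, A ε 0 = 0)
    (hbound : ∀ M : ℝ, ∃ R, ∀ ε, 0 < ε → ε ≤ 1 → ∀ t, |t| ≤ M → |A ε t| ≤ R)
    (hlim : ∀ t, Filter.Tendsto (fun ε => A ε t) (nhdsWithin 0 (Set.Ioi 0)) (nhds (A₀ t))) :
    Filter.Tendsto (fun ε => ∫ x, (‖x‖ ^ 2) ^ a * A ε (u x)) (nhdsWithin 0 (Set.Ioi 0))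
      (nhds (∫ x, (‖x‖ ^ 2) ^ a * A₀ (u x))) := by
  obtain ⟨M, hM⟩ := hucs.exists_bound_of_continuous hu
  obtain ⟨R, hR⟩ := hbound M
  have u0 : ∀ x ∉ tsupport u, u x = 0 := fun x hx => image_eq_zero_of_notMem_tsupport hx
  have hev : ∀ᶠ ε : ℝ in nhdsWithin 0 (Set.Ioi 0), 0 < ε ∧ ε ≤ 1 := by
    filter_upwards [Ioc_mem_nhdsGT (zero_lt_one' ℝ)] with ε hε using hε
  refine tendsto_integral_filter_of_dominated_convergence
    ((tsupport u).indicator fun x => (‖x‖ ^ 2) ^ a * R) ?_ ?_ ?_ ?_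
  · filter_upwards [hev] with ε hε
    exact (integrable_norm_sq_rpow_mul hucs h0 ((hA ε hε.1).comp hu)
      (fun x hx => by simp [u0 x hx, hA0]) a).aestronglyMeasurable
  · filter_upwards [hev] with ε hε
    refine Filter.Eventually.of_forall fun x => ?_
    by_cases hx : x ∈ tsupport u
    · rw [Set.indicator_of_mem hx, norm_mul, Real.norm_of_nonneg (by positivity)]
      exact mul_le_mul_of_nonneg_left (hR ε hε.1 hε.2 _ (hM x)) (by positivity)
    · simp [Set.indicator_of_notMem hx, u0 x hx, hA0]
  · refine IntegrableOn.integrable_indicator ?_ (isClosed_tsupport u).measurableSet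
    refine ContinuousOn.integrableOn_compact hucs fun x hx => ?_
    exact ((contDiffAt_norm_sq_rpow (h0 hx) a).continuousAt.mul
      continuousAt_const).continuousWithinAt
  · exact Filter.Eventually.of_forall fun x => (hlim _).const_mul _

end Calculus

section Regularization

variable {p ε : ℝ}

/-- A smooth approximation of `t ↦ |t| ^ (p - 2) * t`. -/
noncomputable def signedPow (p ε t : ℝ) : ℝ := t * (t ^ 2 + ε) ^ (p / 2 - 1)

/-- The derivative of `signedPow p ε`. -/
noncomputable def signedPowDeriv (p ε t : ℝ) : ℝ :=
  (t ^ 2 + ε) ^ (p / 2 - 1) + (p - 2) * t ^ 2 * (t ^ 2 + ε) ^ (p / 2 - 2)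

/-- The primitive of `signedPow p ε` that vanishes at zero. -/
noncomputable def signedPowPrim (p ε t : ℝ) : ℝ := ((t ^ 2 + ε) ^ (p / 2) - ε ^ (p / 2)) / p

theorem hasDerivAt_sq_add_rpow (hε : 0 < ε) (a t : ℝ) :
    HasDerivAt (fun s : ℝ => (s ^ 2 + ε) ^ a) (2 * t * a * (t ^ 2 + ε) ^ (a - 1)) t := by
  have h := ((hasDerivAt_pow 2 t).add_const ε).rpow_const (p := a) (Or.inl (by positivity))
  simpa using h

theorem hasDerivAt_signedPow (hε : 0 < ε) (t : ℝ) :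
    HasDerivAt (signedPow p ε) (signedPowDeriv p ε t) t := by
  have h := (hasDerivAt_id t).mul (hasDerivAt_sq_add_rpow hε (p / 2 - 1) t)
  refine h.congr_deriv ?_
  have e : p / 2 - 1 - 1 = p / 2 - 2 := by ring
  simp only [signedPowDeriv, id, e]
  ring

theorem hasDerivAt_signedPowPrim (hp : p ≠ 0) (hε : 0 < ε) (t : ℝ) :
    HasDerivAt (signedPowPrim p ε) (signedPow p ε t) t := by
  have h := ((hasDerivAt_sq_add_rpow hε (p / 2) t).sub_const (ε ^ (p / 2))).div_const p
  refine h.congr_deriv ?_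
  simp only [signedPow]
  field_simp

theorem continuous_signedPowDeriv (hε : 0 < ε) : Continuous (signedPowDeriv p ε) := by
  have h (a : ℝ) : Continuous fun t : ℝ => (t ^ 2 + ε) ^ a :=
    (by fun_prop : Continuous fun t : ℝ => t ^ 2 + ε).rpow_const fun t => Or.inl (by positivity)
  exact (h _).add ((by fun_prop : Continuous fun t : ℝ => (p - 2) * t ^ 2).mul (h _))

theorem sq_add_mul_rpow (hε : 0 < ε) (a t : ℝ) :
    (t ^ 2 + ε) ^ a = (t ^ 2 + ε) ^ (a - 1) * (t ^ 2 + ε) := by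
  have h : t ^ 2 + ε ≠ 0 := by positivity
  rw [← Real.rpow_add_one h]; ring_nf

theorem signedPowDeriv_nonneg (hp : 1 ≤ p) (hε : 0 < ε) (t : ℝ) : 0 ≤ signedPowDeriv p ε t := by
  have e := sq_add_mul_rpow hε (p / 2 - 1) t
  have e' : p / 2 - 1 - 1 = p / 2 - 2 := by ring
  rw [e'] at e
  have : signedPowDeriv p ε t = (t ^ 2 + ε) ^ (p / 2 - 2) * ((p - 1) * t ^ 2 + ε) := by
    rw [signedPowDeriv, e]; ring
  rw [this]
  have : 0 ≤ p - 1 := by linarith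
  positivity

theorem mul_signedPow_le (hε : 0 < ε) (t : ℝ) :
    0 ≤ t * signedPow p ε t ∧ t * signedPow p ε t ≤ (t ^ 2 + ε) ^ (p / 2) := by
  have h : t * signedPow p ε t = (t ^ 2 + ε) ^ (p / 2 - 1) * t ^ 2 := by
    rw [signedPow]; ring
  rw [h, sq_add_mul_rpow hε (p / 2)]
  refine ⟨by positivity, ?_⟩
  gcongr
  linarith

theorem abs_signedPow_rpow_le {q : ℝ} (hpq : p.HolderConjugate q) (hε : 0 < ε) (t : ℝ) :
    |signedPow p ε t| ^ q ≤ (t ^ 2 + ε) ^ (p / 2) := by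
  have hs : 0 < t ^ 2 + ε := by positivity
  have ht : |t| ≤ (t ^ 2 + ε) ^ (1 / 2 : ℝ) := by
    rw [← Real.sqrt_eq_rpow]
    exact Real.abs_le_sqrt (by linarith)
  have h : |signedPow p ε t| ≤ (t ^ 2 + ε) ^ ((p - 1) / 2) := by
    rw [signedPow, abs_mul, abs_of_nonneg (Real.rpow_nonneg hs.le _)]
    calc |t| * (t ^ 2 + ε) ^ (p / 2 - 1)
        ≤ (t ^ 2 + ε) ^ (1 / 2 : ℝ) * (t ^ 2 + ε) ^ (p / 2 - 1) := by gcongr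
      _ = (t ^ 2 + ε) ^ ((p - 1) / 2) := by rw [← Real.rpow_add hs]; ring_nf
  calc |signedPow p ε t| ^ q ≤ ((t ^ 2 + ε) ^ ((p - 1) / 2)) ^ q :=
        Real.rpow_le_rpow (abs_nonneg _) h hpq.symm.pos.le
    _ = (t ^ 2 + ε) ^ (p / 2) := by
        have e : (p - 1) / 2 * q = p / 2 := by linarith [hpq.sub_one_mul_conj]
        rw [← Real.rpow_mul hs.le, e]

theorem signedPowDeriv_mul_sq_le (hp : 1 ≤ p) (hε : 0 < ε) (t : ℝ) :
    signedPowDeriv p ε t * t ^ 2 ≤ p * (t ^ 2 + ε) ^ (p / 2) := by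
  have e := sq_add_mul_rpow hε (p / 2) t
  have e1 := sq_add_mul_rpow hε (p / 2 - 1) t
  have e' : p / 2 - 1 - 1 = p / 2 - 2 := by ring
  rw [e'] at e1
  rw [signedPowDeriv, e, e1]
  have hr : 0 ≤ (t ^ 2 + ε) ^ (p / 2 - 2) := by positivity
  have h : 0 ≤ (t ^ 2 + ε) ^ (p / 2 - 2) * (t ^ 2 * ε * (2 * p - 1) + p * ε ^ 2 + t ^ 4) := by
    have : 0 ≤ 2 * p - 1 := by linarith
    positivity
  linarith

theorem signedPowPrim_le (hp : 1 ≤ p) (hε : 0 < ε) (t : ℝ) :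
    0 ≤ signedPowPrim p ε t ∧ signedPowPrim p ε t ≤ (t ^ 2 + ε) ^ (p / 2) := by
  have hp0 : 0 < p := by linarith
  have h1 : ε ^ (p / 2) ≤ (t ^ 2 + ε) ^ (p / 2) :=
    Real.rpow_le_rpow hε.le (by nlinarith [sq_nonneg t]) (by positivity)
  have h2 : 0 ≤ ε ^ (p / 2) := by positivity
  refine ⟨div_nonneg (by linarith) hp0.le, ?_⟩
  rw [signedPowPrim, div_le_iff₀ hp0]
  nlinarith [mul_nonneg (sub_nonneg.2 hp) (h2.trans h1)]

theorem tendsto_sq_add_rpow {t : ℝ} (ht : t ≠ 0) (a : ℝ) :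
    Filter.Tendsto (fun ε : ℝ => (t ^ 2 + ε) ^ a) (nhdsWithin 0 (Set.Ioi 0))
      (nhds (|t| ^ (2 * a))) := by
  have h : ContinuousAt (fun ε : ℝ => (t ^ 2 + ε) ^ a) 0 :=
    (by fun_prop : ContinuousAt (fun ε : ℝ => t ^ 2 + ε) 0).rpow_const
      (Or.inl (by simpa using ht))
  have h' := h.tendsto.mono_left (nhdsWithin_le_nhds (s := Set.Ioi 0))
  rw [Real.rpow_mul (abs_nonneg t)]
  simpa using h'

/-- A linear combination of regularizations of multiples of `t ↦ |t| ^ p`. -/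
noncomputable def powCombination (p q k₁ k₂ k₃ k₄ ε t : ℝ) : ℝ :=
  k₁ * |signedPow p ε t| ^ q + k₂ * (signedPowDeriv p ε t * t ^ 2) + k₃ * signedPowPrim p ε t
    + k₄ * (t * signedPow p ε t)

variable {q : ℝ} (k₁ k₂ k₃ k₄ : ℝ)

theorem powCombination_zero (hq : q ≠ 0) (ε : ℝ) : powCombination p q k₁ k₂ k₃ k₄ ε 0 = 0 := by
  simp [powCombination, signedPow, signedPowPrim, hq]

theorem continuous_powCombination (hpq : p.HolderConjugate q) (hε : 0 < ε) :
    Continuous (powCombination p q k₁ k₂ k₃ k₄ ε) := by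
  have h1 : Continuous (signedPow p ε) :=
    continuous_iff_continuousAt.2 fun t => (hasDerivAt_signedPow hε t).continuousAt
  have h2 : Continuous (signedPowPrim p ε) := continuous_iff_continuousAt.2 fun t =>
    (hasDerivAt_signedPowPrim hpq.ne_zero hε t).continuousAt
  have h3 : Continuous (signedPowDeriv p ε) := continuous_signedPowDeriv hε
  have h4 : Continuous fun t => |signedPow p ε t| ^ q :=
    h1.abs.rpow_const fun _ => Or.inr hpq.symm.pos.le
  unfold powCombination
  fun_prop

theorem abs_powCombination_le (hpq : p.HolderConjugate q) (hε : 0 < ε) (hε1 : ε ≤ 1)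
    {M t : ℝ} (ht : |t| ≤ M) :
    |powCombination p q k₁ k₂ k₃ k₄ ε t|
      ≤ (|k₁| + |k₂| + |k₃| + |k₄|) * (p * (M ^ 2 + 1) ^ (p / 2)) := by
  have hp : 1 ≤ p := hpq.lt.le
  have htM : t ^ 2 ≤ M ^ 2 := sq_le_sq' (by linarith [neg_abs_le t]) ((le_abs_self t).trans ht)
  have hL : (t ^ 2 + ε) ^ (p / 2) ≤ (M ^ 2 + 1) ^ (p / 2) :=
    Real.rpow_le_rpow (by positivity) (by linarith) (by linarith)
  set L := (M ^ 2 + 1) ^ (p / 2) with hLdef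
  have hL0 : 0 ≤ L := by positivity
  have hpL : L ≤ p * L := le_mul_of_one_le_left hL0 hp
  have bound (k : ℝ) {s : ℝ} (h0 : 0 ≤ s) (h1 : s ≤ p * L) : |k * s| ≤ |k| * (p * L) := by
    rw [abs_mul, abs_of_nonneg h0]
    gcongr
  have b1 := bound k₁ (by positivity) (((abs_signedPow_rpow_le hpq hε t).trans hL).trans hpL)
  have b2 := bound k₂ (mul_nonneg (signedPowDeriv_nonneg hp hε t) (sq_nonneg t))
    ((signedPowDeriv_mul_sq_le hp hε t).trans (by gcongr))
  have b3 := bound k₃ (signedPowPrim_le hp hε t).1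
    (((signedPowPrim_le hp hε t).2.trans hL).trans hpL)
  have b4 := bound k₄ (mul_signedPow_le hε t).1
    (((mul_signedPow_le hε t).2.trans hL).trans hpL)
  have := abs_add_le (k₁ * |signedPow p ε t| ^ q + k₂ * (signedPowDeriv p ε t * t ^ 2)
    + k₃ * signedPowPrim p ε t) (k₄ * (t * signedPow p ε t))
  have := abs_add_three (k₁ * |signedPow p ε t| ^ q) (k₂ * (signedPowDeriv p ε t * t ^ 2))
    (k₃ * signedPowPrim p ε t)
  rw [powCombination]
  linarith

theorem tendsto_powCombination (hpq : p.HolderConjugate q) (t : ℝ) :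
    Filter.Tendsto (fun ε => powCombination p q k₁ k₂ k₃ k₄ ε t) (nhdsWithin 0 (Set.Ioi 0))
      (nhds ((k₁ + k₂ * (p - 1) + k₃ / p + k₄) * |t| ^ p)) := by
  have hp0 : 0 < p := hpq.pos
  rcases eq_or_ne t 0 with rfl | ht
  · simp [powCombination_zero _ _ _ _ hpq.symm.ne_zero, hpq.ne_zero]
  have hat : 0 < |t| := abs_pos.2 ht
  have ε0 : Filter.Tendsto (fun ε : ℝ => ε ^ (p / 2)) (nhdsWithin 0 (Set.Ioi 0)) (nhds 0) := by
    have h := (Real.continuousAt_rpow_const 0 (p / 2) (Or.inr (by positivity))).tendsto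
    rw [Real.zero_rpow (by positivity)] at h
    exact h.mono_left nhdsWithin_le_nhds
  have l1 := tendsto_sq_add_rpow ht (p / 2 - 1)
  have l2 := tendsto_sq_add_rpow ht (p / 2 - 2)
  have l0 := tendsto_sq_add_rpow ht (p / 2)
  have s1 : |t| ^ (2 * (p / 2 - 1)) * t ^ 2 = |t| ^ p := by
    rw [← sq_abs t, ← Real.rpow_natCast, ← Real.rpow_add hat]
    congr 1; push_cast; ring
  have s2 : |t| ^ (2 * (p / 2 - 2)) * t ^ 4 = |t| ^ p := by
    rw [← Even.pow_abs (by decide : Even 4) t, ← Real.rpow_natCast, ← Real.rpow_add hat]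
    congr 1; push_cast; ring
  have s0 : |t| ^ (2 * (p / 2)) = |t| ^ p := by congr 1; ring
  have sq : |t * |t| ^ (2 * (p / 2 - 1))| ^ q = |t| ^ p := by
    rw [abs_mul, abs_of_nonneg (Real.rpow_nonneg hat.le _), ← Real.rpow_one_add' hat.le,
      ← Real.rpow_mul hat.le]
    · congr 1; linarith [hpq.sub_one_mul_conj]
    · linarith [hpq.lt]
  have t1 : Filter.Tendsto (fun ε => signedPow p ε t) (nhdsWithin 0 (Set.Ioi 0))
      (nhds (t * |t| ^ (2 * (p / 2 - 1)))) := l1.const_mul t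
  have m1 := (t1.abs.rpow_const (p := q) (Or.inr hpq.symm.pos.le)).const_mul k₁
  have m2 := ((l1.add (l2.const_mul ((p - 2) * t ^ 2))).mul_const (t ^ 2)).const_mul k₂
  have m3 := ((l0.sub ε0).div_const p).const_mul k₃
  have m4 := (t1.const_mul t).const_mul k₄
  have h := ((m1.add m2).add m3).add m4
  refine (h.congr fun ε => rfl).trans (le_of_eq ?_)
  congr 1
  rw [sq, s0]
  linear_combination (k₂ + k₄) * s1 + k₂ * (p - 2) * s2

end Regularization

/-- `L^p` Rellich inequality (Okazawa): for `n ≥ 3`, `1 < p < n/2`, and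
`u ∈ C^∞_c(ℝⁿ \ {0})`,
`∫ |Δu|^p ≥ (n/p − 2)^p (n(p−1)/p)^p ∫ |x|^{−2p}|u|^p`. -/
theorem rellich_okazawa {n : ℕ} (hn : 3 ≤ n) (p : ℝ) (hp : 1 < p)
    (hpn : p < (n : ℝ) / 2)
    (u : EuclideanSpace ℝ (Fin n) → ℝ)
    (hu : ContDiff ℝ (⊤ : ℕ∞) u) (hucs : HasCompactSupport u)
    (h0 : tsupport u ⊆ {(0 : EuclideanSpace ℝ (Fin n))}ᶜ) :
    ((n : ℝ) / p - 2) ^ p * ((n : ℝ) * (p - 1) / p) ^ p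
        * ∫ x, ‖x‖ ^ (-(2 : ℝ) * p) * |u x| ^ p
      ≤ ∫ x, |elap u x| ^ p := by
  have hp0 : 0 < p := by linarith
  have hc : 0 < (n : ℝ) / p - 2 := by
    rw [sub_pos, lt_div_iff₀ hp0]; linarith
  have hd : 0 < (n : ℝ) * (p - 1) / p := by
    have : 0 < (n : ℝ) := by linarith
    have : 0 < p - 1 := by linarith
    positivity
  have hpq : p.HolderConjugate (p / (p - 1)) := Real.HolderConjugate.conjExponent hp
  set q := p / (p - 1) with hq
  set c := (n : ℝ) / p - 2 with hcdef
  set C := c * ((n : ℝ) * (p - 1) / p) with hCdef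
  have hC : 0 < C := mul_pos hc hd
  let A := powCombination p q (C ^ p / q) (C ^ (p - 1) * c ^ 2)
    (C ^ (p - 1) * ((n - 2 * p) * (2 - 2 * p + 2 * c))) (-(C ^ (p - 1) * ((n - 2 * p) * (2 * c))))
  have step (ε : ℝ) (hε : 0 < ε) :
      0 ≤ (∫ x, |elap u x| ^ p) / p + ∫ x, (‖x‖ ^ 2) ^ (-p) * A ε (u x) := by
    have hE (t : ℝ) := ((hasDerivAt_signedPowPrim hp0.ne' hε t).const_mul (2 - 2 * p)).sub
      ((((hasDerivAt_id t).mul (hasDerivAt_signedPow (p := p) hε t)).sub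
        (hasDerivAt_signedPowPrim hp0.ne' hε t)).const_mul (2 * c))
    have h := integral_abs_elap_rpow_regularized (c := c) hpq hC.le hu hucs h0
      (hasDerivAt_signedPow hε) (continuous_signedPowDeriv hε)
      (signedPowDeriv_nonneg hp.le hε) (by simp [signedPow])
      (fun t => (hE t).congr_deriv (by simp only [id]; ring))
      (by simp [signedPowPrim])
    refine h.trans (le_of_eq ?_)
    congr 2
    ext x
    simp only [A, powCombination, Pi.sub_apply, Pi.mul_apply, id]
    ring
  have hlim := tendsto_integral_weighted_comp (A := A) (-p) hu.continuous hucs h0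
    (fun ε hε => continuous_powCombination _ _ _ _ hpq hε)
    (powCombination_zero _ _ _ _ hpq.symm.ne_zero)
    (fun M => ⟨_, fun ε hε hε1 t ht => abs_powCombination_le _ _ _ _ hpq hε hε1 ht⟩)
    (tendsto_powCombination _ _ _ _ hpq)
  have hfinal := ge_of_tendsto (hlim.const_add ((∫ x, |elap u x| ^ p) / p))
    (by filter_upwards [self_mem_nhdsWithin] with ε hε using step ε hε)
  have hCp : C ^ p = C ^ (p - 1) * C := by
    rw [← Real.rpow_add_one hC.ne']; ring_nf
  have hcoef : C ^ p / q + C ^ (p - 1) * c ^ 2 * (p - 1)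
      + C ^ (p - 1) * ((n - 2 * p) * (2 - 2 * p + 2 * c)) / p
      + -(C ^ (p - 1) * ((n - 2 * p) * (2 * c))) = -(C ^ p / p) := by
    have hp1 : p - 1 ≠ 0 := by linarith
    have hnc : (n : ℝ) = p * (c + 2) := by rw [hcdef]; field_simp; ring
    have hCc : C = c * (c + 2) * (p - 1) := by
      rw [hCdef, hnc]; field_simp
    rw [hCp, hq]
    generalize C ^ (p - 1) = K
    rw [hCc, hnc]
    field_simp
    ring
  rw [hcoef] at hfinal
  have hI : ∫ x, (‖x‖ ^ 2) ^ (-p) * (-(C ^ p / p) * |u x| ^ p)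
      = -(C ^ p / p) * ∫ x, ‖x‖ ^ (-(2 : ℝ) * p) * |u x| ^ p := by
    rw [← integral_const_mul]
    congr 1
    ext x
    have : (‖x‖ ^ 2) ^ (-p) = ‖x‖ ^ (-(2 : ℝ) * p) := by
      rw [← Real.rpow_natCast, ← Real.rpow_mul (norm_nonneg x)]
      congr 1; push_cast; ring
    rw [this]; ring
  rw [hI] at hfinal
  rw [← Real.mul_rpow hc.le hd.le, ← hCdef]
  have h := mul_nonneg hp0.le hfinal
  have e : p * ((∫ x, |elap u x| ^ p) / p
      + -(C ^ p / p) * ∫ x, ‖x‖ ^ (-(2 : ℝ) * p) * |u x| ^ p)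
      = (∫ x, |elap u x| ^ p) - C ^ p * ∫ x, ‖x‖ ^ (-(2 : ℝ) * p) * |u x| ^ p := by
    field_simp
    ring
  linarith
end
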